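/- arXiv:2303.14780 — 6 statements merged into one kernel-verified Lean document; each statement's English description precedes it below -/
import Mathlib

section
/- There exists a homeomorphism f : S² → S² whose non-wandering set Ω(f) consists of exactly one point and whose generalized entropy satisfies o(f) = [n], the order of growth of the identity sequence a(n) = n. -/
open Filter

/-- The non-wandering set of a map: points every neighborhood of which
returns to itself under some positive iterate. -/
def nonwanderingSet {X : Type*} [TopologicalSpace X] (f : X → X) : Set X :=
  {x | ∀ U ∈ nhds x, ∃ n, 1 ≤ n ∧ ((f^[n]) '' U ∩ U).Nonempty}

/-- A sequence `ℕ → (0,∞)` (indexed by `n ≥ 1`), nondecreasing. -/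
def GrowthSeq (a : ℕ → ℝ) : Prop :=
  (∀ n : ℕ, 1 ≤ n → 0 < a n) ∧ (∀ n : ℕ, 1 ≤ n → a n ≤ a (n + 1))

/-- `E` is an `(n,ε)`-separated set for `f`. -/
def IsSeparatedSet {M : Type*} [MetricSpace M] (f : M → M) (ε : ℝ) (n : ℕ)
    (E : Finset M) : Prop :=
  ∀ x ∈ E, ∀ y ∈ E, x ≠ y → ∃ k, k < n ∧ ε ≤ dist (f^[k] x) (f^[k] y)

/-- `s_{f,ε}(n) ≤ C·b(n)` for all `n ≥ 1`, for every `ε > 0` (with `C` depending on `ε`):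
the order of growth `[b]` is an upper bound of all `[s_{f,ε}]`. -/
def SepDominated {M : Type*} [MetricSpace M] (f : M → M) (b : ℕ → ℝ) : Prop :=
  ∀ ε : ℝ, 0 < ε → ∃ C : ℝ, 0 < C ∧
    ∀ n : ℕ, 1 ≤ n → ∀ E : Finset M, IsSeparatedSet f ε n E → (E.card : ℝ) ≤ C * b n

/-- The generalized entropy of `f` equals the order of growth `[a]`
(Dedekind–MacNeille characterization of `sup_{ε>0}[s_{f,ε}] = [a]`). -/
def HasGenEntropy {M : Type*} [MetricSpace M] (f : M → M) (a : ℕ → ℝ) : Prop :=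
  SepDominated f a ∧
    ∀ b : ℕ → ℝ, GrowthSeq b → SepDominated f b →
      ∃ C : ℝ, 0 < C ∧ ∀ n : ℕ, 1 ≤ n → a n ≤ C * b n

/-- The unit sphere in `ℝ³` with its induced metric. -/
abbrev S2 := Metric.sphere (0 : EuclideanSpace ℝ (Fin 3)) 1

/-- The finite-time Bowen balls of a continuous map on a compact space have finite subcovers, so
separated sets of bounded length have bounded cardinality. -/
lemma exists_card_le_of_isSeparatedSet {M : Type*} [MetricSpace M] [CompactSpace M] {f : M → M}
    (hf : Continuous f) {ε : ℝ} (hε : 0 < ε) (m : ℕ) :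
    ∃ B : ℕ, ∀ E : Finset M, IsSeparatedSet f ε m E → E.card ≤ B := by
  let U : M → Set M := fun x => ⋂ k ∈ Finset.range m, (f^[k]) ⁻¹' Metric.ball (f^[k] x) (ε / 2)
  have hU (x : M) : U x ∈ nhds x :=
    (Filter.biInter_finset_mem _).2 fun k _ =>
      (hf.iterate k).continuousAt (Metric.ball_mem_nhds _ (half_pos hε))
  obtain ⟨T, hT⟩ := CompactSpace.elim_nhds_subcover U hU
  have hcover (x : M) : ∃ c ∈ T, x ∈ U c := by
    simpa using (Set.ext_iff.1 hT x).2 trivial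
  choose c hcT hcU using hcover
  refine ⟨T.card, fun E hE => Finset.card_le_card_of_injOn c (fun x _ => hcT x) ?_⟩
  intro x hx y hy hxy
  by_contra hne
  obtain ⟨k, hk, hsep⟩ := hE x hx y hy hne
  have near (z : M) : dist (f^[k] z) (f^[k] (c z)) < ε / 2 :=
    Set.mem_iInter₂.1 (hcU z) k (Finset.mem_range.2 hk)
  have hx' := near x
  have hy' := near y
  rw [← hxy] at hy'
  linarith [dist_triangle_right (f^[k] x) (f^[k] y) (f^[k] (c x))]

/-- If all points outside each ball around `p` return to the ball for good within a uniform time,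
then the separated sets grow at most linearly. -/
lemma sepDominated_linear_of_uniform_escape {M : Type*} [MetricSpace M] [CompactSpace M]
    {f : M → M} (hf : Continuous f) (hinj : Function.Injective f) {p : M}
    (hesc : ∀ ε : ℝ, 0 < ε → ∃ m : ℕ, ∀ k, m ≤ k → ∀ x ∉ Metric.ball p ε,
      f^[k] x ∈ Metric.ball p ε) :
    SepDominated f (fun n => (n : ℝ)) := by
  classical
  intro ε hε
  obtain ⟨m, hm⟩ := hesc (ε / 2) (half_pos hε)
  obtain ⟨B, hB⟩ := exists_card_le_of_isSeparatedSet hf hε m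
  refine ⟨2 * B + 1, by positivity, fun n hn E hE => ?_⟩
  have hentry (x : M) : ∃ t, n ≤ t ∨ f^[t] x ∉ Metric.ball p (ε / 2) := ⟨n, Or.inl le_rfl⟩
  let τ : M → ℕ := fun x => Nat.find (hentry x)
  have hτ (x : M) : n ≤ τ x ∨ f^[τ x] x ∉ Metric.ball p (ε / 2) := Nat.find_spec (hentry x)
  have hτmin (x : M) {k : ℕ} (hk : k < τ x) : f^[k] x ∈ Metric.ball p (ε / 2) := by
    have := Nat.find_min (hentry x) hk
    tauto
  have hclose {a b : M} (ha : a ∈ Metric.ball p (ε / 2)) (hb : b ∈ Metric.ball p (ε / 2)) :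
      dist a b < ε := by
    rw [Metric.mem_ball] at ha hb
    linarith [dist_triangle_right a b p]
  have hfiber (t : ℕ) : (E.filter fun x => τ x = t).card ≤ B := by
    rw [← Finset.card_image_of_injective _ (hinj.iterate t)]
    refine hB _ ?_
    intro x' hx' y' hy' hne
    simp only [Finset.mem_image, Finset.mem_filter] at hx' hy'
    obtain ⟨x, ⟨hx, hxt⟩, rfl⟩ := hx'
    obtain ⟨y, ⟨hy, hyt⟩, rfl⟩ := hy'
    obtain ⟨k, hk, hsep⟩ := hE x hx y hy fun h => hne (h ▸ rfl)
    have htk : t ≤ k := by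
      by_contra! h
      exact (hclose (hτmin x (hxt ▸ h)) (hτmin y (hyt ▸ h))).not_ge hsep
    obtain ⟨j, rfl⟩ := Nat.exists_eq_add_of_le' htk
    have hxo := (hτ x).resolve_left (by omega)
    have hyo := (hτ y).resolve_left (by omega)
    rw [hxt] at hxo
    rw [hyt] at hyo
    simp only [Function.iterate_add_apply] at hsep
    refine ⟨j, ?_, hsep⟩
    by_contra! h
    exact (hclose (hm j h _ hxo) (hm j h _ hyo)).not_ge hsep
  have hcard : E.card ≤ B * (n + 1) := by
    simpa using Finset.card_le_mul_card_image_of_maps_to (f := τ) (s := E)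
      (t := Finset.range (n + 1))
      (fun x _ => Finset.mem_range.2 (Nat.lt_succ_of_le (Nat.find_min' _ (Or.inl le_rfl))))
      B (fun t _ => hfiber t)
  have hcard' : (E.card : ℝ) ≤ B * (n + 1) := by exact_mod_cast hcard
  have hn' : (1 : ℝ) ≤ n := by exact_mod_cast hn
  nlinarith [(Nat.cast_nonneg B : (0 : ℝ) ≤ B)]

/-- A uniformly escaping map has no non-wandering points other than `p`. -/
lemma nonwanderingSet_eq_singleton_of_uniform_escape {M : Type*} [MetricSpace M]
    {f : M → M} (hf : Continuous f) {p : M} (hp : f p = p)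
    (hesc : ∀ ε : ℝ, 0 < ε → ∃ m : ℕ, ∀ k, m ≤ k → ∀ x ∉ Metric.ball p ε,
      f^[k] x ∈ Metric.ball p ε) :
    nonwanderingSet f = {p} := by
  ext x
  refine ⟨fun hx => ?_, ?_⟩
  · by_contra hne
    have hd : 0 < dist x p := dist_pos.2 hne
    obtain ⟨m, hm⟩ := hesc (dist x p / 2) (half_pos hd)
    have hnofix (k : ℕ) (hk : 1 ≤ k) : f^[k] x ≠ x := by
      intro h
      have hfix : f^[m * k] x = x := by
        rw [mul_comm, Function.iterate_mul]
        exact Function.iterate_fixed h m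
      have := hm (m * k) (Nat.le_mul_of_pos_right m hk) x (by simp [Metric.mem_ball])
      rw [hfix, Metric.mem_ball] at this
      linarith
    have hsep (k : ℕ) (hk : 1 ≤ k) : ∃ V ∈ nhds x, Disjoint ((f^[k]) '' V) V := by
      obtain ⟨A, B, hA, hB, hxA, hxB, hAB⟩ := t2_separation (hnofix k hk)
      refine ⟨(f^[k]) ⁻¹' A ∩ B, inter_mem ((hf.iterate k).continuousAt (hA.mem_nhds hxA))
        (hB.mem_nhds hxB), hAB.mono ?_ Set.inter_subset_right⟩
      exact Set.image_subset_iff.2 Set.inter_subset_left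
    choose! V hVx hV using hsep
    let U : Set M := {y | dist x p / 2 < dist y p} ∩ ⋂ k ∈ Finset.Icc 1 m, V k
    have hU : U ∈ nhds x := by
      refine inter_mem ?_ ((Filter.biInter_finset_mem _).2 fun k hk =>
        hVx k (Finset.mem_Icc.1 hk).1)
      exact (isOpen_lt continuous_const (by fun_prop)).mem_nhds (half_lt_self hd)
    obtain ⟨n, hn, _, ⟨y, hy, rfl⟩, hy'⟩ := hx U hU
    by_cases hnm : n ≤ m
    · have hmem : n ∈ Finset.Icc 1 m := Finset.mem_Icc.2 ⟨hn, hnm⟩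
      exact Set.disjoint_left.1 (hV n hn) ⟨y, Set.mem_iInter₂.1 hy.2 n hmem, rfl⟩
        (Set.mem_iInter₂.1 hy'.2 n hmem)
    · have h1 : dist x p / 2 < dist y p := hy.1
      have h2 : dist x p / 2 < dist (f^[n] y) p := hy'.1
      have := hm n (by omega) y (by rw [Metric.mem_ball]; linarith)
      rw [Metric.mem_ball] at this
      linarith
  · rintro rfl U hU
    exact ⟨1, le_rfl, x, ⟨x, mem_of_mem_nhds hU, by simpa using hp⟩, mem_of_mem_nhds hU⟩

/-- A bi-infinite orbit one of whose points is isolated in it produces linearly many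
separated points. -/
lemma le_const_mul_of_isolated_orbit {M : Type*} [MetricSpace M] {f : M → M} {z : ℤ → M}
    (hz : ∀ j, f (z j) = z (j + 1)) {ε : ℝ} (hε : 0 < ε)
    (hiso : ∀ j : ℤ, j ≠ 0 → ε ≤ dist (z 0) (z j)) {b : ℕ → ℝ} (hb : SepDominated f b) :
    ∃ C : ℝ, 0 < C ∧ ∀ n : ℕ, 1 ≤ n → (n : ℝ) ≤ C * b n := by
  classical
  have hiter (k : ℕ) (j : ℤ) : f^[k] (z j) = z (j + k) := by
    induction k with
    | zero => simp
    | succ k ih => rw [Function.iterate_succ_apply', ih, hz]; push_cast; ring_nf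
  have hsep {i j : ℕ} (h : i ≠ j) : ε ≤ dist (f^[i] (z (-i))) (f^[i] (z (-j))) := by
    rw [hiter, hiter, neg_add_cancel]
    exact hiso _ (by omega)
  have hinj : Function.Injective fun i : ℕ => z (-i) := by
    intro i j hij
    by_contra hne
    have hle := hsep hne
    simp only at hij
    rw [hij, dist_self] at hle
    linarith
  obtain ⟨C, hC, hCb⟩ := hb ε hε
  refine ⟨C, hC, fun n hn => ?_⟩
  have := hCb n hn ((Finset.range n).image fun i : ℕ => z (-i)) ?_
  · simpa [Finset.card_image_of_injective _ hinj] using this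
  · intro x hx y hy hne
    simp only [Finset.mem_image, Finset.mem_range] at hx hy
    obtain ⟨i, hi, rfl⟩ := hx
    obtain ⟨j, hj, rfl⟩ := hy
    exact ⟨i, hi, hsep fun h => hne (h ▸ rfl)⟩

/-- There is a homeomorphism of `S²` with exactly one non-wandering point and
generalized entropy `[n]`. -/
theorem exists_genEntropy_linear :
    ∃ f : S2 ≃ₜ S2, (∃ p : S2, nonwanderingSet (⇑f) = {p}) ∧
      HasGenEntropy (⇑f) (fun n => (n : ℝ)) := by
  let V := EuclideanSpace ℝ (Fin 2)
  let v : V := EuclideanSpace.single 0 1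
  have hv : ‖v‖ = 1 := (PiLp.norm_single 2 (fun _ : Fin 2 => ℝ) 0 1).trans norm_one
  let φ : OnePoint V ≃ₜ S2 := onePointEquivSphereOfFinrankEq (by simp [V])
  let f : S2 ≃ₜ S2 := (φ.symm.trans (Homeomorph.addRight v).onePointCongr).trans φ
  let p : S2 := φ OnePoint.infty
  have hp : f p = p := by
    change φ (OnePoint.map _ (φ.symm (φ OnePoint.infty))) = _
    simp [p]
  have hfv (w : V) : f (φ w) = φ ((w + v : V) : OnePoint V) := by
    change φ (OnePoint.map _ (φ.symm (φ w))) = _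
    simp
  have hiter (k : ℕ) (w : V) : f^[k] (φ w) = φ ((w + k • v : V) : OnePoint V) := by
    induction k with
    | zero => simp
    | succ k ih => rw [Function.iterate_succ_apply', ih, hfv, succ_nsmul, add_assoc]
  have hesc (ε : ℝ) (hε : 0 < ε) : ∃ m : ℕ, ∀ k, m ≤ k → ∀ x ∉ Metric.ball p ε,
      f^[k] x ∈ Metric.ball p ε := by
    have hK : IsCompact ((fun w : V => φ (w : OnePoint V)) ⁻¹' (Metric.ball p ε)ᶜ) := by
      have hopen : IsOpen (φ ⁻¹' Metric.ball p ε) := Metric.isOpen_ball.preimage φ.continuous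
      exact ((OnePoint.isOpen_iff_of_mem (by simpa [p] using hε)).1 hopen).2
    obtain ⟨R, hR⟩ := hK.isBounded.exists_norm_le
    obtain ⟨m, hm⟩ := exists_nat_gt (2 * R)
    refine ⟨m, fun k hk x hx => ?_⟩
    obtain ⟨y, rfl⟩ := φ.surjective x
    induction y using OnePoint.rec with
    | infty => exact absurd (Metric.mem_ball_self hε) hx
    | coe w =>
      by_contra hk'
      rw [hiter] at hk'
      have h1 := hR w hx
      have h2 := hR (w + k • v) hk'
      have h3 : ‖k • v‖ = k := by rw [← Nat.cast_smul_eq_nsmul ℝ, norm_smul, hv]; simp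
      have h4 : ‖k • v‖ ≤ ‖w + k • v‖ + ‖w‖ := by
        simpa using norm_sub_le (w + k • v) w
      have h5 : (m : ℝ) ≤ k := by exact_mod_cast hk
      linarith
  refine ⟨f, ⟨p, nonwanderingSet_eq_singleton_of_uniform_escape f.continuous hp hesc⟩,
    sepDominated_linear_of_uniform_escape f.continuous f.injective hesc, fun b _ hb => ?_⟩
  let z : ℤ → S2 := fun j => φ ((j • v : V) : OnePoint V)
  have hz (j : ℤ) : f (z j) = z (j + 1) := by
    simp only [z]
    rw [hfv, add_smul, one_smul]
  have hemb : Topology.IsOpenEmbedding fun w : V => φ (w : OnePoint V) :=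
    φ.isOpenEmbedding.comp OnePoint.isOpenEmbedding_coe
  have hnhds : (fun w : V => φ (w : OnePoint V)) '' Metric.ball 0 1 ∈ nhds (z 0) :=
    (hemb.isOpenMap _ Metric.isOpen_ball).mem_nhds ⟨0, by simp, by simp [z]⟩
  obtain ⟨ε, hε, hball⟩ := Metric.mem_nhds_iff.1 hnhds
  refine le_const_mul_of_isolated_orbit hz hε (fun j hj => ?_) hb
  by_contra! hlt
  obtain ⟨w, hw, hwj⟩ := hball (Metric.mem_ball'.2 hlt)
  have hw' : w = j • v := hemb.injective hwj
  rw [hw', mem_ball_zero_iff, ← Int.cast_smul_eq_zsmul ℝ, norm_smul, hv, mul_one,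
    Real.norm_eq_abs] at hw
  have : |j| < 1 := by exact_mod_cast hw
  exact hj (Int.abs_lt_one_iff.1 this)
end

section
/- There exist homeomorphisms f₁, f₂ : S² → S², each with non-wandering set consisting of exactly one point, such that o(f₁) = [n²] and o(f₂) = [n²·log(n+1)]. In particular o(f₁) ≠ o(f₂): there is no constant C > 0 with n²·log(n+1) ≤ C·n² for all n ≥ 1, even though both sequences n² and n²·log(n+1) are bounded above and below (up to multiplicative constants) by n² and n³ respectively, so f₁ and f₂ have the same polynomial entropy 2. -/
open Filter

open Real (exp log sigmoid)

/-- The flow on `ℝ` that is conjugate on `(0, 1)` to the translations of `ℝ` via the sigmoid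
function and fixes `0` and `1`. -/
noncomputable def shift (c s : ℝ) : ℝ := exp c * s / (1 - s + exp c * s)

lemma sigmoid_eq_exp_div (t : ℝ) : sigmoid t = exp t / (1 + exp t) := by
  rw [Real.sigmoid_def, Real.exp_neg]
  have := Real.exp_pos t
  field_simp
  ring

lemma shift_sigmoid (c t : ℝ) : shift c (sigmoid t) = sigmoid (t + c) := by
  have := Real.exp_pos t
  have := Real.exp_pos c
  have h1 : 0 < 1 + exp t * exp c := by positivity
  rw [shift, sigmoid_eq_exp_div, sigmoid_eq_exp_div, Real.exp_add]
  field_simp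
  rw [div_eq_iff (by ring_nf; positivity)]
  ring

lemma shift_zero_right (c : ℝ) : shift c 0 = 0 := by simp [shift]

lemma shift_one_right (c : ℝ) : shift c 1 = 1 := by
  simp [shift]

lemma exists_sigmoid_eq {s : ℝ} (h0 : 0 < s) (h1 : s < 1) : ∃ t, sigmoid t = s := by
  have : s ∈ Set.range sigmoid := by rw [Real.range_sigmoid]; exact ⟨h0, h1⟩
  exact this

lemma eq_zero_or_one_or_sigmoid {s : ℝ} (h0 : 0 ≤ s) (h1 : s ≤ 1) :
    s = 0 ∨ s = 1 ∨ ∃ t, s = sigmoid t := by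
  rcases h0.eq_or_lt with h | h
  · exact Or.inl h.symm
  rcases h1.eq_or_lt with h' | h'
  · exact Or.inr (Or.inl h')
  obtain ⟨t, ht⟩ := exists_sigmoid_eq h h'
  exact Or.inr (Or.inr ⟨t, ht.symm⟩)

lemma shift_denom_pos (c : ℝ) {s : ℝ} (h0 : 0 ≤ s) (h1 : s ≤ 1) :
    0 < 1 - s + exp c * s := by
  have := Real.exp_pos c
  rcases h0.eq_or_lt with h | h
  · simp [← h]
  · nlinarith [mul_pos this h]

lemma shift_nonneg (c : ℝ) {s : ℝ} (h0 : 0 ≤ s) (h1 : s ≤ 1) : 0 ≤ shift c s :=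
  div_nonneg (mul_nonneg (Real.exp_pos c).le h0) (shift_denom_pos c h0 h1).le

lemma shift_le_one (c : ℝ) {s : ℝ} (h0 : 0 ≤ s) (h1 : s ≤ 1) : shift c s ≤ 1 := by
  rw [shift, div_le_one (shift_denom_pos c h0 h1)]
  linarith

lemma shift_shift (c d : ℝ) {s : ℝ} (h0 : 0 ≤ s) (h1 : s ≤ 1) :
    shift c (shift d s) = shift (d + c) s := by
  rcases eq_zero_or_one_or_sigmoid h0 h1 with rfl | rfl | ⟨t, rfl⟩
  · simp [shift_zero_right]
  · simp [shift_one_right]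
  · simp [shift_sigmoid, add_assoc]

lemma shift_zero_left (s : ℝ) : shift 0 s = s := by simp [shift]

lemma continuousOn_shift (c : ℝ) : ContinuousOn (shift c) (Set.Icc 0 1) := by
  unfold shift
  refine ContinuousOn.div (by fun_prop) (by fun_prop) fun s hs => ?_
  exact (shift_denom_pos c hs.1 hs.2).ne'

lemma sigmoid_transition (a t : ℝ) :
    exp (-a) * sigmoid t * (1 - sigmoid (t - a)) = sigmoid (t - a) * (1 - sigmoid t) := by
  have := Real.exp_pos t
  have := Real.exp_pos a
  rw [sigmoid_eq_exp_div, sigmoid_eq_exp_div, Real.exp_sub, Real.exp_neg]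
  field_simp
  ring

lemma eq_sub_of_sigmoid_transition {a t t' : ℝ}
    (h : exp (-a) * sigmoid t * (1 - sigmoid t') = sigmoid t' * (1 - sigmoid t)) :
    t' = t - a := by
  have h1 := Real.exp_pos t
  have h2 := Real.exp_pos t'
  rw [sigmoid_eq_exp_div, sigmoid_eq_exp_div] at h
  have : exp (-a) * exp t = exp t' := by
    field_simp at h
    linarith
  rw [← Real.exp_add, Real.exp_eq_exp] at this
  linarith

lemma shift_transition {k s s' : ℝ} (c : ℝ) (h0 : 0 ≤ s) (h1 : s ≤ 1) (h0' : 0 ≤ s')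
    (h1' : s' ≤ 1) (h : k * s * (1 - s') = s' * (1 - s)) :
    k * shift c s * (1 - shift c s') = shift c s' * (1 - shift c s) := by
  have hd := shift_denom_pos c h0 h1
  have hd' := shift_denom_pos c h0' h1'
  have e (x : ℝ) (hx : 0 < 1 - x + exp c * x) : 1 - shift c x = (1 - x) / (1 - x + exp c * x) := by
    rw [shift]; field_simp; ring
  rw [e s hd, e s' hd', shift, shift]
  generalize 1 - s + exp c * s = d at hd
  generalize 1 - s' + exp c * s' = d' at hd'
  field_simp
  linear_combination h

lemma abs_sigmoid_sub_le (a b : ℝ) : |sigmoid a - sigmoid b| ≤ |a - b| := by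
  have h : LipschitzWith 1 sigmoid := by
    refine lipschitzWith_of_nnnorm_deriv_le differentiable_sigmoid fun x => ?_
    rw [← NNReal.coe_le_coe, coe_nnnorm, Real.deriv_sigmoid, Real.norm_eq_abs, abs_le]
    have := Real.sigmoid_pos x
    have := Real.sigmoid_lt_one x
    constructor <;> simp <;> nlinarith
  simpa [Real.dist_eq] using h.dist_le_mul a b

/-- The transition factor of a flow box whose transit time is `h y⁻¹`; it vanishes on the
nonpositive orbits, which are never transited. -/
noncomputable def transition (h : ℝ → ℝ) (y : ℝ) : ℝ := if 0 < y then exp (-h y⁻¹) else 0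

lemma transition_of_pos (h : ℝ → ℝ) {y : ℝ} (hy : 0 < y) : transition h y = exp (-h y⁻¹) :=
  if_pos hy

lemma transition_of_nonpos (h : ℝ → ℝ) {y : ℝ} (hy : y ≤ 0) : transition h y = 0 :=
  if_neg hy.not_gt

lemma transition_nonneg (h : ℝ → ℝ) (y : ℝ) : 0 ≤ transition h y := by
  unfold transition; split_ifs <;> positivity

lemma continuous_transition {h : ℝ → ℝ} (hc : Continuous h) (ht : Tendsto h atTop atTop) :
    Continuous (transition h) := by
  rw [continuous_iff_continuousAt]
  intro y
  rcases lt_trichotomy y 0 with hy | rfl | hy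
  · refine (continuousAt_const (y := (0 : ℝ))).congr ?_
    filter_upwards [Iio_mem_nhds hy] with z hz
    exact (transition_of_nonpos h (le_of_lt hz)).symm
  · rw [← continuousWithinAt_univ, ← Set.Iic_union_Ioi (a := (0 : ℝ))]
    refine ContinuousWithinAt.union ?_ ?_
    · refine (continuousWithinAt_const (b := (0 : ℝ))).congr ?_ ?_
      · intro z hz; exact transition_of_nonpos h hz
      · exact transition_of_nonpos h le_rfl
    · rw [ContinuousWithinAt, transition_of_nonpos h le_rfl]
      have : Tendsto (fun y : ℝ => exp (-h y⁻¹)) (nhdsWithin 0 (Set.Ioi 0)) (nhds 0) :=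
        Real.tendsto_exp_neg_atTop_nhds_zero.comp (ht.comp tendsto_inv_nhdsGT_zero)
      refine this.congr' ?_
      filter_upwards [self_mem_nhdsWithin] with z hz
      exact (transition_of_pos h hz).symm
  · have : ContinuousAt (fun y : ℝ => exp (-h y⁻¹)) y := by
      have := continuousAt_inv₀ hy.ne'
      fun_prop
    refine this.congr ?_
    filter_upwards [Ioi_mem_nhds hy] with z hz
    exact (transition_of_pos h hz).symm

/-- A closed subset of `ℝ × [0, 1]³`: the second component of `(y, s)` consists of the
compactified time coordinates, in three flow boxes, of a point on an orbit labelled by `y`.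
The transit times between consecutive flow boxes are `y⁻¹` and `h y⁻¹` if `0 < y`. -/
def flowSpace (h : ℝ → ℝ) : Set (ℝ × (Fin 3 → ℝ)) :=
  {w | (∀ i, 0 ≤ w.2 i ∧ w.2 i ≤ 1) ∧
    transition id w.1 * w.2 0 * (1 - w.2 1) = w.2 1 * (1 - w.2 0) ∧
    transition h w.1 * w.2 1 * (1 - w.2 2) = w.2 2 * (1 - w.2 1)}

/-- The points of `flowSpace h` that are not fixed by the flow. -/
def movingSpace (h : ℝ → ℝ) : Set (ℝ × (Fin 3 → ℝ)) :=
  {w | w ∈ flowSpace h ∧ ∃ i, 0 < w.2 i ∧ w.2 i < 1}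

lemma isClosed_flowSpace {h : ℝ → ℝ} (hc : Continuous h) (ht : Tendsto h atTop atTop) :
    IsClosed (flowSpace h) := by
  have h1 := continuous_transition continuous_id (tendsto_id (α := ℝ) (x := atTop))
  have h2 := continuous_transition hc ht
  unfold flowSpace
  simp only [Set.ofPred_and, Set.ofPred_forall]
  refine IsClosed.inter (isClosed_iInter fun i => IsClosed.inter ?_ ?_) (IsClosed.inter ?_ ?_)
  · exact isClosed_le (by fun_prop) (by fun_prop)
  · exact isClosed_le (by fun_prop) (by fun_prop)
  · exact isClosed_eq (by fun_prop) (by fun_prop)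
  · exact isClosed_eq (by fun_prop) (by fun_prop)

/-- The time-`c` map of the flow. -/
noncomputable def flow (c : ℝ) (w : ℝ × (Fin 3 → ℝ)) : ℝ × (Fin 3 → ℝ) :=
  (w.1, fun i => shift c (w.2 i))

lemma flow_mem_flowSpace {h : ℝ → ℝ} (c : ℝ) {w : ℝ × (Fin 3 → ℝ)} (hw : w ∈ flowSpace h) :
    flow c w ∈ flowSpace h := by
  obtain ⟨h1, h2, h3⟩ := hw
  exact ⟨fun i => ⟨shift_nonneg c (h1 i).1 (h1 i).2, shift_le_one c (h1 i).1 (h1 i).2⟩,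
    shift_transition c (h1 0).1 (h1 0).2 (h1 1).1 (h1 1).2 h2,
    shift_transition c (h1 1).1 (h1 1).2 (h1 2).1 (h1 2).2 h3⟩

lemma flow_mem_movingSpace {h : ℝ → ℝ} (c : ℝ) {w : ℝ × (Fin 3 → ℝ)} (hw : w ∈ movingSpace h) :
    flow c w ∈ movingSpace h := by
  obtain ⟨h1, i, h2, h3⟩ := hw
  refine ⟨flow_mem_flowSpace c h1, i, ?_⟩
  obtain ⟨t, ht⟩ := exists_sigmoid_eq h2 h3
  simp only [flow, ← ht, shift_sigmoid]
  exact ⟨Real.sigmoid_pos _, Real.sigmoid_lt_one _⟩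

lemma flow_flow {h : ℝ → ℝ} (c d : ℝ) {w : ℝ × (Fin 3 → ℝ)} (hw : w ∈ movingSpace h) :
    flow c (flow d w) = flow (d + c) w := by
  ext i
  · rfl
  · exact shift_shift c d (hw.1.1 i).1 (hw.1.1 i).2

lemma flow_zero (w : ℝ × (Fin 3 → ℝ)) : flow 0 w = w := by
  ext i
  · rfl
  · exact shift_zero_left _

lemma continuousOn_flow (h : ℝ → ℝ) (c : ℝ) : ContinuousOn (flow c) (movingSpace h) := by
  refine ContinuousOn.prodMk (by fun_prop) (continuousOn_pi.2 fun i => ?_)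
  exact (continuousOn_shift c).comp (by fun_prop) fun w hw => hw.1.1 i

/-- The time-one map of the flow on the moving points. -/
noncomputable def movingMap (h : ℝ → ℝ) : movingSpace h ≃ₜ movingSpace h where
  toFun w := ⟨flow 1 w, flow_mem_movingSpace 1 w.2⟩
  invFun w := ⟨flow (-1) w, flow_mem_movingSpace (-1) w.2⟩
  left_inv w := Subtype.ext <|
    (flow_flow _ _ w.2).trans (by rw [add_neg_cancel, flow_zero])
  right_inv w := Subtype.ext <|
    (flow_flow _ _ w.2).trans (by rw [neg_add_cancel, flow_zero])
  continuous_toFun := ((continuousOn_flow h 1).domRestrict).subtype_mk _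
  continuous_invFun := ((continuousOn_flow h (-1)).domRestrict).subtype_mk _

lemma movingMap_iterate (h : ℝ → ℝ) (n : ℕ) (w : movingSpace h) :
    ((movingMap h)^[n] w : ℝ × (Fin 3 → ℝ)) = flow n w := by
  induction n with
  | zero => simp [flow_zero]
  | succ k ih =>
    rw [Function.iterate_succ_apply']
    change flow 1 ((movingMap h)^[k] w : ℝ × (Fin 3 → ℝ)) = _
    rw [ih, flow_flow _ _ w.2]
    push_cast
    rfl

lemma le_of_transition {k a b a' b' : ℝ} (hk : 0 ≤ k) (ha : 0 ≤ a)
    (ha' : a' ≤ 1) (hb' : 0 ≤ b') (hb1 : b ≤ 1)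
    (h : k * a * (1 - b) = b * (1 - a)) (h' : k * a' * (1 - b') = b' * (1 - a'))
    (hlt : a < a') : b ≤ b' := by
  by_contra! hbb
  have h1 : k * a * (1 - b) ≤ k * a' * (1 - b') := by
    apply mul_le_mul _ _ (by linarith) (mul_nonneg hk (by linarith))
    · exact mul_le_mul_of_nonneg_left hlt.le hk
    · linarith
  nlinarith [mul_pos (sub_pos.2 hbb) (sub_pos.2 hlt),
    mul_nonneg (sub_pos.2 hbb).le (sub_nonneg.2 ha')]

lemma eq_of_transition {k a b a' : ℝ} (hk : 0 < k) (hb : 0 ≤ b) (hb1 : b ≤ 1)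
    (h : k * a * (1 - b) = b * (1 - a)) (h' : k * a' * (1 - b) = b * (1 - a')) :
    a = a' := by
  have h1 : (a - a') * (k * (1 - b) + b) = 0 := by linear_combination h - h'
  rcases mul_eq_zero.1 h1 with h2 | h2
  · linarith
  · exfalso
    rcases hb1.eq_or_lt with h3 | h3
    · rw [h3] at h2; norm_num at h2
    · nlinarith [mul_pos hk (sub_pos.2 h3)]

lemma eq_of_transition_of_lt {k a b a' : ℝ} (hk : 0 ≤ k) (hb : 0 ≤ b) (hb1 : b ≤ 1)
    (ha' : a' ≤ 1) (h : k * a * (1 - b) = b * (1 - a)) (h' : k * a' * (1 - b) = b * (1 - a'))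
    (hlt : a < a') : b = 0 := by
  rcases hk.eq_or_lt with rfl | hk
  · have : b * (1 - a) = 0 := by linarith
    rcases mul_eq_zero.1 this with h1 | h1
    · exact h1
    · linarith
  · exact absurd (eq_of_transition hk hb hb1 h h') hlt.ne

lemma not_crossing {h : ℝ → ℝ} {y : ℝ} {s r : Fin 3 → ℝ} (hs : (y, s) ∈ flowSpace h)
    (hr : (y, r) ∈ flowSpace h) (i j : Fin 3) (hi : s i < r i) : s j ≤ r j := by
  obtain ⟨hs, hs1, hs2⟩ := hs
  obtain ⟨hr, hr1, hr2⟩ := hr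
  dsimp only at *
  have hk1 := transition_nonneg id y
  have hk2 := transition_nonneg h y
  have l01 : s 0 < r 0 → s 1 ≤ r 1 :=
    le_of_transition hk1 (hs 0).1 (hr 0).2 (hr 1).1 (hs 1).2 hs1 hr1
  have l10 : s 1 < r 1 → s 0 ≤ r 0 := fun hl => by
    by_contra! hlt
    linarith [le_of_transition hk1 (hr 0).1 (hs 0).2 (hs 1).1 (hr 1).2 hr1 hs1 hlt]
  have l12 : s 1 < r 1 → s 2 ≤ r 2 :=
    le_of_transition hk2 (hs 1).1 (hr 1).2 (hr 2).1 (hs 2).2 hs2 hr2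
  have l21 : s 2 < r 2 → s 1 ≤ r 1 := fun hl => by
    by_contra! hlt
    linarith [le_of_transition hk2 (hr 1).1 (hs 1).2 (hs 2).1 (hr 2).2 hr2 hs2 hlt]
  have l02 : s 0 < r 0 → s 2 ≤ r 2 := fun hl => by
    rcases (l01 hl).eq_or_lt with e | e
    · rw [← e] at hr1 hr2
      have h0 := eq_of_transition_of_lt hk1 (hs 1).1 (hs 1).2 (hr 0).2 hs1 hr1 hl
      rw [h0] at hs2 hr2
      linarith
    · exact l12 e
  have l20 : s 2 < r 2 → s 0 ≤ r 0 := fun hl => by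
    rcases (l21 hl).eq_or_lt with e | e
    · by_contra! hlt
      rw [← e] at hr1 hr2
      have h0 := eq_of_transition_of_lt hk1 (hs 1).1 (hs 1).2 (hs 0).2 hr1 hs1 hlt
      rw [h0] at hs2 hr2
      linarith
    · exact l10 e
  fin_cases i <;> fin_cases j <;> first | exact hi.le | (simp only [Fin.reduceFinMk] at *; tauto)

/-- A point of `flowSpace h` is determined by its orbit label and the sum of its compactified
time coordinates. -/
noncomputable def position (w : ℝ × (Fin 3 → ℝ)) : ℝ × ℝ := (w.1, w.2 0 + w.2 1 + w.2 2)

lemma continuous_position : Continuous position := by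
  unfold position; fun_prop

lemma injOn_position (h : ℝ → ℝ) : Set.InjOn position (flowSpace h) := by
  rintro ⟨y, s⟩ hs ⟨y', r⟩ hr hsr
  simp only [position, Prod.mk.injEq] at hsr
  obtain ⟨rfl, hsum⟩ := hsr
  have key : ∀ {s r : Fin 3 → ℝ}, (y, s) ∈ flowSpace h → (y, r) ∈ flowSpace h →
      s 0 + s 1 + s 2 = r 0 + r 1 + r 2 → ∀ i, r i ≤ s i := by
    intro s r hs hr hsum i
    by_contra! hi
    have := not_crossing hs hr i
    have h0 := this 0 hi
    have h1 := this 1 hi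
    have h2 := this 2 hi
    fin_cases i <;> simp only [Fin.reduceFinMk, Fin.zero_eta, Fin.mk_one] at hi <;> linarith
  ext i
  · rfl
  · exact le_antisymm (key hr hs hsum.symm i) (key hs hr hsum i)

lemma isClosedEmbedding_position {h : ℝ → ℝ} (hc : Continuous h) (ht : Tendsto h atTop atTop) :
    Topology.IsClosedEmbedding ((flowSpace h).domRestrict position) := by
  have hcont : Continuous ((flowSpace h).domRestrict position) :=
    continuous_position.continuousOn.domRestrict
  refine .of_continuous_injective_isClosedMap hcont
    (Set.injOn_iff_injective.1 (injOn_position h)) (IsProperMap.isClosedMap ?_)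
  rw [isProperMap_iff_isCompact_preimage]
  refine ⟨hcont, fun K hK => ?_⟩
  rw [Subtype.isCompact_iff]
  have hbox : IsCompact (((Prod.fst '' K) ×ˢ Set.univ.pi fun _ : Fin 3 => Set.Icc (0 : ℝ) 1)) :=
    (hK.image continuous_fst).prod (isCompact_univ_pi fun _ => isCompact_Icc)
  refine hbox.of_isClosed_subset ?_ ?_
  · have : (Subtype.val '' ((flowSpace h).domRestrict position ⁻¹' K)) =
        flowSpace h ∩ position ⁻¹' K := by
      ext w
      constructor
      · rintro ⟨w, hw, rfl⟩
        exact ⟨w.2, hw⟩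
      · rintro ⟨h1, h2⟩
        exact ⟨⟨w, h1⟩, h2, rfl⟩
    rw [this]
    exact (isClosed_flowSpace hc ht).inter (hK.isClosed.preimage continuous_position)
  · rintro _ ⟨w, hw, rfl⟩
    exact ⟨⟨_, hw, rfl⟩, fun i _ => w.2.1 i⟩

/-- The strip `ℝ × (0, 3)` without the two rays above `1` and `2` given by nonpositive `y`. -/
def slitStrip : Set (ℝ × ℝ) :=
  {q | 0 < q.2 ∧ q.2 < 3 ∧ (q.2 = 1 ∨ q.2 = 2 → 0 < q.1)}

lemma position_mem_slitStrip {h : ℝ → ℝ} {w : ℝ × (Fin 3 → ℝ)} (hw : w ∈ movingSpace h) :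
    position w ∈ slitStrip := by
  obtain ⟨⟨hs, h1, h2⟩, i, hi0, hi1⟩ := hw
  obtain ⟨y, s⟩ := w
  dsimp only at *
  have a0 := hs 0
  have a1 := hs 1
  have a2 := hs 2
  have hpos : 0 < s 0 + s 1 + s 2 := by
    fin_cases i <;> simp only [Fin.reduceFinMk, Fin.zero_eta, Fin.mk_one] at hi0 <;> linarith
  have hlt : s 0 + s 1 + s 2 < 3 := by
    fin_cases i <;> simp only [Fin.reduceFinMk, Fin.zero_eta, Fin.mk_one] at hi1 <;> linarith
  refine ⟨hpos, hlt, fun hx => ?_⟩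
  change s 0 + s 1 + s 2 = 1 ∨ s 0 + s 1 + s 2 = 2 at hx
  by_contra! hy
  change y ≤ 0 at hy
  simp only [transition_of_nonpos _ hy, zero_mul, zero_eq_mul] at h1 h2
  have hi : (0 < s 0 ∧ s 0 < 1) ∨ (0 < s 1 ∧ s 1 < 1) ∨ (0 < s 2 ∧ s 2 < 1) := by
    fin_cases i <;> simp_all
  grind

lemma exists_position_eq (h : ℝ → ℝ) {q : ℝ × ℝ} (hq : q ∈ slitStrip) :
    ∃ w ∈ movingSpace h, position w = q := by
  obtain ⟨y, x⟩ := q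
  obtain ⟨h0, h3, hx⟩ := hq
  dsimp only at *
  rcases le_or_gt y 0 with hy | hy
  · have hx1 : x ≠ 1 := fun e => by linarith [hx (Or.inl e)]
    have hx2 : x ≠ 2 := fun e => by linarith [hx (Or.inr e)]
    rcases hx1.lt_or_gt with l1 | l1
    · refine ⟨(y, ![x, 0, 0]), ⟨⟨?_, ?_, ?_⟩, 0, ?_⟩, ?_⟩
      · intro i; fin_cases i <;> simp only [Fin.reduceFinMk, Fin.zero_eta, Fin.mk_one, Matrix.cons_val] <;>
        constructor <;> linarith
      all_goals simp [transition_of_nonpos _ hy, position, h0, l1]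
    rcases hx2.lt_or_gt with l2 | l2
    · refine ⟨(y, ![1, x - 1, 0]), ⟨⟨?_, ?_, ?_⟩, 1, ?_⟩, ?_⟩
      · intro i; fin_cases i <;> simp only [Fin.reduceFinMk, Fin.zero_eta, Fin.mk_one, Matrix.cons_val] <;>
        constructor <;> linarith
      · simp [transition_of_nonpos _ hy]
      · simp [transition_of_nonpos _ hy]
      · constructor <;> simp <;> linarith
      · simp [position]
    · refine ⟨(y, ![1, 1, x - 2]), ⟨⟨?_, ?_, ?_⟩, 2, ?_⟩, ?_⟩
      · intro i; fin_cases i <;> simp only [Fin.reduceFinMk, Fin.zero_eta, Fin.mk_one, Matrix.cons_val] <;>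
        constructor <;> linarith
      · simp [transition_of_nonpos _ hy]
      · simp [transition_of_nonpos _ hy]
      · constructor <;> simp <;> linarith
      · simp [position]; ring
  · let a := y⁻¹
    let b := a + h a
    have hF : ContinuousOn (fun s => s + shift (-a) s + shift (-b) s) (Set.Icc 0 1) :=
      (continuousOn_id.add (continuousOn_shift _)).add (continuousOn_shift _)
    have hmem : x ∈ Set.Icc ((fun s => s + shift (-a) s + shift (-b) s) 0)
        ((fun s => s + shift (-a) s + shift (-b) s) 1) := by
      simp only [shift_zero_right, shift_one_right]
      constructor <;> linarith
    obtain ⟨s, hs, hsx⟩ := intermediate_value_Icc zero_le_one hF hmem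
    dsimp only at hsx
    rcases eq_zero_or_one_or_sigmoid hs.1 hs.2 with rfl | rfl | ⟨t, rfl⟩
    · simp only [shift_zero_right] at hsx; linarith
    · simp only [shift_one_right] at hsx; linarith
    refine ⟨(y, ![sigmoid t, sigmoid (t - a), sigmoid (t - a - h a)]), ⟨⟨?_, ?_, ?_⟩, 0, ?_⟩, ?_⟩
    · intro i; fin_cases i <;> simp [Real.sigmoid_nonneg, Real.sigmoid_le_one]
    · simpa [transition_of_pos _ hy] using sigmoid_transition a t
    · simpa [transition_of_pos _ hy] using sigmoid_transition (h a) (t - a)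
    · simp [Real.sigmoid_pos, Real.sigmoid_lt_one]
    · rw [← hsx, shift_sigmoid, shift_sigmoid]
      simp [position, b, sub_eq_add_neg, add_assoc]
      ring_nf

/-- The space of moving points is homeomorphic to the slit strip. -/
lemma nonempty_homeomorph_slitStrip {h : ℝ → ℝ} (hc : Continuous h)
    (ht : Tendsto h atTop atTop) : Nonempty (movingSpace h ≃ₜ slitStrip) := by
  have hsub : movingSpace h ⊆ flowSpace h := fun w hw => hw.1
  have hemb := (isClosedEmbedding_position hc ht).isEmbedding.comp
    (Topology.IsEmbedding.inclusion hsub)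
  refine ⟨hemb.toHomeomorph.trans (Homeomorph.setCongr ?_)⟩
  ext q
  constructor
  · rintro ⟨w, rfl⟩
    exact position_mem_slitStrip w.2
  · intro hq
    obtain ⟨w, hw, rfl⟩ := exists_position_eq h hq
    exact ⟨⟨w, hw⟩, rfl⟩

/-- The defining function of the slits of `slitStrip`. -/
def slitFun (x : ℝ) : ℝ := (x - 1) * (x - 2)

/-- On each vertical line of the slit strip, `y ↦ (y + √(y ^ 2 + d ^ 2)) / 2`, where `d` vanishes
exactly on the slits, is a homeomorphism onto `(0, ∞)`. -/
noncomputable def slitHeight (q : ℝ × ℝ) : ℝ := (q.1 + √(q.1 ^ 2 + slitFun q.2 ^ 2)) / 2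

lemma slitHeight_pos {q : ℝ × ℝ} (hq : q ∈ slitStrip) : 0 < slitHeight q := by
  obtain ⟨y, x⟩ := q
  have h := hq.2.2
  dsimp only [slitHeight] at *
  have h0 := Real.sqrt_nonneg (y ^ 2 + slitFun x ^ 2)
  rcases lt_or_ge 0 y with hy | hy
  · linarith
  · have hd : slitFun x ≠ 0 := by
      intro h1
      rcases mul_eq_zero.1 h1 with h2 | h2
      · linarith [h (Or.inl (by linarith))]
      · linarith [h (Or.inr (by linarith))]
    have : |y| < √(y ^ 2 + slitFun x ^ 2) := by
      rw [← Real.sqrt_sq_eq_abs]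
      exact Real.sqrt_lt_sqrt (sq_nonneg y) (by have := sq_pos_of_ne_zero hd; linarith)
    rw [abs_of_nonpos hy] at this
    linarith

lemma slitHeight_sub {q : ℝ × ℝ} (hq : q ∈ slitStrip) :
    slitHeight q - slitFun q.2 ^ 2 / (4 * slitHeight q) = q.1 := by
  have hpos := slitHeight_pos hq
  have hs := Real.sq_sqrt (by positivity : 0 ≤ q.1 ^ 2 + slitFun q.2 ^ 2)
  have he : 2 * slitHeight q - q.1 = √(q.1 ^ 2 + slitFun q.2 ^ 2) := by
    unfold slitHeight; ring
  rw [← he] at hs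
  field_simp
  linear_combination hs

lemma slitHeight_eq {y x e : ℝ} (he : 0 < e) (hy : y = e - slitFun x ^ 2 / (4 * e)) :
    slitHeight (y, x) = e := by
  have h1 : y ^ 2 + slitFun x ^ 2 = (e + slitFun x ^ 2 / (4 * e)) ^ 2 := by
    rw [hy]; field_simp; ring
  unfold slitHeight
  dsimp only
  rw [h1, Real.sqrt_sq (by positivity), hy]
  ring

lemma sigmoid_log {s : ℝ} (h0 : 0 < s) (h1 : s < 1) : sigmoid (log (s / (1 - s))) = s := by
  have h2 : 0 < 1 - s := by linarith
  rw [sigmoid_eq_exp_div, Real.exp_log (by positivity)]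
  field_simp
  ring

lemma log_sigmoid_div (t : ℝ) : log (sigmoid t / (1 - sigmoid t)) = t :=
  Real.sigmoid_injective <| sigmoid_log (Real.sigmoid_pos t) (Real.sigmoid_lt_one t)

/-- The slit strip is homeomorphic to the plane. -/
noncomputable def slitStripHomeomorph : slitStrip ≃ₜ ℝ × ℝ where
  toFun q := (log (slitHeight q), log (q.1.2 / 3 / (1 - q.1.2 / 3)))
  invFun p := ⟨(exp p.1 - slitFun (3 * sigmoid p.2) ^ 2 / (4 * exp p.1), 3 * sigmoid p.2), by
    have h0 := Real.sigmoid_pos p.2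
    have h1 := Real.sigmoid_lt_one p.2
    refine ⟨by dsimp only; linarith, by dsimp only; linarith, fun h => ?_⟩
    dsimp only at h ⊢
    have : slitFun (3 * sigmoid p.2) = 0 := by
      rcases h with h | h <;> simp [slitFun, h]
    simp [this, Real.exp_pos]⟩
  left_inv q := by
    have hx : 3 * sigmoid (log (q.1.2 / 3 / (1 - q.1.2 / 3))) = q.1.2 := by
      rw [sigmoid_log (by linarith [q.2.1]) (by linarith [q.2.2.1])]
      ring
    refine Subtype.ext (Prod.ext ?_ ?_)
    · simp only [hx, Real.exp_log (slitHeight_pos q.2), slitHeight_sub q.2]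
    · exact hx
  right_inv p := by
    refine Prod.ext ?_ ?_
    · dsimp only
      rw [slitHeight_eq (Real.exp_pos _) rfl, Real.log_exp]
    · dsimp only
      rw [mul_div_cancel_left₀ _ (by norm_num), log_sigmoid_div]
  continuous_toFun := by
    have hc : Continuous fun q : slitStrip => slitHeight q := by
      unfold slitHeight slitFun; fun_prop
    refine (hc.log fun q => (slitHeight_pos q.2).ne').prodMk (Continuous.log ?_ fun q => ?_)
    · refine Continuous.div (by fun_prop) (by fun_prop) fun q => ?_
      linarith [q.2.2.1]
    · have h0 := q.2.1
      have h3 := q.2.2.1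
      have : 0 < 1 - q.1.2 / 3 := by linarith
      positivity
  continuous_invFun := by
    have hs : Continuous sigmoid := continuous_sigmoid
    refine Continuous.subtype_mk (Continuous.prodMk (Continuous.sub (by fun_prop) ?_)
      (by fun_prop)) _
    refine Continuous.div (by unfold slitFun; fun_prop) (by fun_prop) fun p => ?_
    positivity

lemma nonempty_onePoint_homeomorph_sphere {h : ℝ → ℝ} (hc : Continuous h)
    (ht : Tendsto h atTop atTop) : Nonempty (OnePoint (movingSpace h) ≃ₜ S2) := by
  obtain ⟨e⟩ := nonempty_homeomorph_slitStrip hc ht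
  exact ⟨(e.trans slitStripHomeomorph).onePointCongr.trans
    (onePointEquivSphereOfFinrankEq (by simp))⟩

/-- The homeomorphism of the sphere induced by the time-one map of the flow. -/
noncomputable def sphereMap {h : ℝ → ℝ} (e : OnePoint (movingSpace h) ≃ₜ S2) : S2 ≃ₜ S2 :=
  (e.symm.trans (movingMap h).onePointCongr).trans e

lemma sphereMap_coe {h : ℝ → ℝ} (e : OnePoint (movingSpace h) ≃ₜ S2) (w : movingSpace h) :
    sphereMap e (e w) = e (movingMap h w) := by
  simp only [sphereMap, Homeomorph.trans_apply, Homeomorph.symm_apply_apply]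
  rfl

lemma sphereMap_infty {h : ℝ → ℝ} (e : OnePoint (movingSpace h) ≃ₜ S2) :
    sphereMap e (e OnePoint.infty) = e OnePoint.infty := by
  simp only [sphereMap, Homeomorph.trans_apply, Homeomorph.symm_apply_apply]
  rfl

lemma sphereMap_iterate {h : ℝ → ℝ} (e : OnePoint (movingSpace h) ≃ₜ S2) (n : ℕ)
    (w : movingSpace h) : (sphereMap e)^[n] (e w) = e ((movingMap h)^[n] w) := by
  induction n with
  | zero => rfl
  | succ k ih => rw [Function.iterate_succ_apply', ih, sphereMap_coe, Function.iterate_succ_apply']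

lemma eq_infty_or_exists_eq {h : ℝ → ℝ} (e : OnePoint (movingSpace h) ≃ₜ S2) (x : S2) :
    x = e OnePoint.infty ∨ ∃ w : movingSpace h, e w = x := by
  obtain ⟨z, rfl⟩ := e.surjective x
  cases z with
  | infty => exact Or.inl rfl
  | coe w => exact Or.inr ⟨w, rfl⟩

lemma isOpenEmbedding_sphere_coe {h : ℝ → ℝ} (e : OnePoint (movingSpace h) ≃ₜ S2) :
    Topology.IsOpenEmbedding fun w : movingSpace h => e w :=
  e.isOpenEmbedding.comp OnePoint.isOpenEmbedding_coe

lemma nonwanderingSet_sphereMap {h : ℝ → ℝ} (e : OnePoint (movingSpace h) ≃ₜ S2) :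
    nonwanderingSet (sphereMap e) = {e OnePoint.infty} := by
  ext x
  constructor
  · intro hx
    rcases eq_infty_or_exists_eq e x with rfl | ⟨w, rfl⟩
    · rfl
    exfalso
    obtain ⟨i, hi0, hi1⟩ := w.2.2
    obtain ⟨t, ht⟩ := exists_sigmoid_eq hi0 hi1
    let V : Set (movingSpace h) :=
      (fun v => v.1.2 i) ⁻¹' Set.Ioo (sigmoid (t - 1 / 2)) (sigmoid (t + 1 / 2))
    have hV : IsOpen V := isOpen_Ioo.preimage (by fun_prop)
    have hwV : w ∈ V := by
      constructor <;> beta_reduce <;> rw [← ht] <;> exact Real.sigmoid_lt (by linarith)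
    have hU := (isOpenEmbedding_sphere_coe e).isOpenMap V hV
    obtain ⟨n, hn, z, ⟨_, ⟨v, hv, rfl⟩, hz⟩, ⟨v', hv', rfl⟩⟩ := hx _ (hU.mem_nhds ⟨w, hwV, rfl⟩)
    dsimp only at hz
    rw [sphereMap_iterate] at hz
    have hz' := (isOpenEmbedding_sphere_coe e).injective hz
    obtain ⟨s, hs⟩ := exists_sigmoid_eq ((Real.sigmoid_pos _).trans hv.1)
      (hv.2.trans (Real.sigmoid_lt_one _))
    have hv2 := hv'.2
    beta_reduce at hv2 hs
    rw [← hz', movingMap_iterate] at hv2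
    have hv1 := hv.1
    beta_reduce at hv1
    rw [← hs, Real.sigmoid_lt_iff] at hv1
    simp only [flow, ← hs, shift_sigmoid, Real.sigmoid_lt_iff] at hv2
    have : (1 : ℝ) ≤ n := by exact_mod_cast hn
    linarith
  · rintro rfl U hU
    refine ⟨1, le_rfl, e OnePoint.infty, ⟨_, mem_of_mem_nhds hU, ?_⟩, mem_of_mem_nhds hU⟩
    exact sphereMap_infty e

/-- Truncation of a real number to `[-R, R]`. -/
noncomputable def truncate (R y : ℝ) : ℝ := max (-R) (min R y)

lemma truncate_of_abs_le {R y : ℝ} (hy : |y| ≤ R) : truncate R y = y := by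
  rw [abs_le] at hy
  rw [truncate, min_eq_right hy.2, max_eq_right hy.1]

lemma truncate_eq_self_of_lt {R y : ℝ} (h1 : -R < truncate R y) (h2 : truncate R y < R) :
    truncate R y = y := by
  unfold truncate at *
  grind

/-- Points of the sphere are close if their time coordinates and truncated orbit labels are. -/
lemma exists_dist_lt_of_coords {h : ℝ → ℝ} (e : OnePoint (movingSpace h) ≃ₜ S2) {ε : ℝ}
    (hε : 0 < ε) : ∃ δ > 0, ∃ R : ℕ, ∀ u v : movingSpace h,
      |truncate R u.1.1 - truncate R v.1.1| < δ → (∀ i, |u.1.2 i - v.1.2 i| < δ) →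
      dist (e u) (e v) < ε := by
  let f : movingSpace h → S2 := fun w => e w
  have hf : Topology.IsOpenEmbedding f := isOpenEmbedding_sphere_coe e
  let B := Metric.ball (e OnePoint.infty) (ε / 2)
  have hBr : Bᶜ ⊆ Set.range f := fun x hx => by
    rcases eq_infty_or_exists_eq e x with rfl | hw
    · exact absurd (Metric.mem_ball_self (half_pos hε)) hx
    · exact hw
  have hK : IsCompact (f ⁻¹' Bᶜ) :=
    (hf.isInducing.isCompact_preimage_iff hBr).2 Metric.isOpen_ball.isClosed_compl.isCompact
  have hun := hK.uniformContinuousAt_of_continuousAt f (fun a _ => hf.continuous.continuousAt)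
    (Metric.dist_mem_uniformity hε)
  obtain ⟨δ, hδ, hd⟩ := Metric.mem_uniformity_dist.1 hun
  obtain ⟨M, hM⟩ := hK.exists_bound_of_continuousOn (f := fun w => w.1.1) (by fun_prop)
  obtain ⟨R, hR⟩ := exists_nat_gt (M + 1)
  refine ⟨min δ 1, by positivity, R, fun u v hy hs => ?_⟩
  have key : ∀ u v : movingSpace h, u ∈ f ⁻¹' Bᶜ →
      |truncate R u.1.1 - truncate R v.1.1| < min δ 1 → (∀ i, |u.1.2 i - v.1.2 i| < min δ 1) →
      dist (f u) (f v) < ε := by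
    intro u v hu hy hs
    refine hd ?_ hu
    have hu1 := hM u hu
    rw [Real.norm_eq_abs] at hu1
    rw [truncate_of_abs_le (by linarith : |u.1.1| ≤ R)] at hy
    rw [abs_le] at hu1
    have hy1 := abs_lt.1 (hy.trans_le (min_le_right _ _))
    rw [truncate_eq_self_of_lt (by linarith) (by linarith)] at hy
    rw [Subtype.dist_eq, Prod.dist_eq, max_lt_iff, dist_pi_lt_iff hδ]
    exact ⟨hy.trans_le (min_le_left _ _), fun i => (hs i).trans_le (min_le_left _ _)⟩
  by_cases hu : u ∈ f ⁻¹' Bᶜ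
  · exact key u v hu hy hs
  by_cases hv : v ∈ f ⁻¹' Bᶜ
  · rw [dist_comm]
    exact key v u hv (by rwa [abs_sub_comm]) fun i => by rw [abs_sub_comm]; exact hs i
  have hu' : dist (e u) (e OnePoint.infty) < ε / 2 := by
    simpa [B, f] using hu
  have hv' : dist (e v) (e OnePoint.infty) < ε / 2 := by
    simpa [B, f] using hv
  linarith [dist_triangle_right (e u) (e v) (e OnePoint.infty)]

/-- The time coordinate, in units of `1 / N` and truncated to `[-(n + T), T]`. -/
noncomputable def timeCode (N n T : ℕ) (s : ℝ) : ℤ :=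
  if s ≤ 0 then -(N * (n + T)) else if 1 ≤ s then N * T else
    max (-(N * (n + T))) (min (N * T) ⌊N * log (s / (1 - s))⌋)

lemma timeCode_sigmoid (N n T : ℕ) (t : ℝ) :
    timeCode N n T (sigmoid t) = max (-(N * (n + T) : ℤ)) (min (N * T : ℤ) ⌊N * t⌋) := by
  rw [timeCode, if_neg (Real.sigmoid_pos t).not_ge, if_neg (Real.sigmoid_lt_one t).not_ge,
    log_sigmoid_div]

lemma timeCode_zero (N n T : ℕ) : timeCode N n T 0 = -(N * (n + T)) := by simp [timeCode]

lemma timeCode_one (N n T : ℕ) : timeCode N n T 1 = N * T := by simp [timeCode]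

lemma timeCode_mem_Icc (N n T : ℕ) (s : ℝ) :
    timeCode N n T s ∈ Finset.Icc (-(N * (n + T) : ℤ)) (N * T) := by
  have : -(N * (n + T) : ℤ) ≤ N * T := by
    have h1 : (0 : ℤ) ≤ N * (n + T) := by positivity
    have h2 : (0 : ℤ) ≤ N * T := by positivity
    linarith
  rw [Finset.mem_Icc, timeCode]
  split_ifs
  · exact ⟨le_rfl, this⟩
  · exact ⟨this, le_rfl⟩
  · exact ⟨le_max_left _ _, max_le this (min_le_left _ _)⟩

lemma sigmoid_of_timeCode_ne {N n T : ℕ} (hN : 0 < N) {s : ℝ} (h0 : 0 ≤ s) (h1 : s ≤ 1)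
    (hb : timeCode N n T s ≠ -(N * (n + T))) (ht : timeCode N n T s ≠ N * T) :
    ∃ t, s = sigmoid t ∧ timeCode N n T s = ⌊N * t⌋ ∧ -(n + T : ℝ) ≤ t ∧ t ≤ T := by
  rcases eq_zero_or_one_or_sigmoid h0 h1 with rfl | rfl | ⟨t, rfl⟩
  · exact absurd (timeCode_zero N n T) hb
  · exact absurd (timeCode_one N n T) ht
  have hc := timeCode_sigmoid N n T t
  have hN' : (0 : ℝ) < N := by exact_mod_cast hN
  have hfl : timeCode N n T (sigmoid t) = ⌊N * t⌋ := by grind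
  refine ⟨t, rfl, hfl, ?_, ?_⟩
  · have h2 : (-(N * (n + T)) : ℤ) ≤ ⌊N * t⌋ := by grind
    rw [Int.le_floor] at h2
    push_cast at h2
    nlinarith
  · have h2 : ⌊N * t⌋ < (N * T : ℤ) := by grind
    rw [Int.floor_lt] at h2
    push_cast at h2
    nlinarith

lemma shift_le_of_timeCode_eq {N n T : ℕ} (hN : 0 < N) (hn : 0 < n) {s : ℝ} (h0 : 0 ≤ s)
    (h1 : s ≤ 1) (hb : timeCode N n T s = -(N * (n + T))) {k : ℕ} (hk : k < n) :
    shift k s ≤ 1 - sigmoid (T - 1) := by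
  have hN' : (0 : ℝ) < N := by exact_mod_cast hN
  have hNn : (0 : ℤ) < N * (n + T) := by positivity
  have hNT : (0 : ℤ) ≤ N * T := by positivity
  rcases eq_zero_or_one_or_sigmoid h0 h1 with rfl | rfl | ⟨t, rfl⟩
  · rw [shift_zero_right]
    linarith [Real.sigmoid_lt_one (T - 1 : ℝ)]
  · rw [timeCode_one] at hb
    linarith
  · rw [timeCode_sigmoid] at hb
    have h2 : ⌊N * t⌋ < (-(N * (n + T)) : ℤ) + 1 := by grind
    rw [Int.floor_lt] at h2
    push_cast at h2
    have h3 : (1 : ℝ) ≤ N := by exact_mod_cast hN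
    have h4 : (k : ℝ) < n := by exact_mod_cast hk
    have h5 : t < -(n + T) + 1 := by
      by_contra! h
      nlinarith
    rw [shift_sigmoid, ← Real.sigmoid_neg]
    exact Real.sigmoid_le (by linarith)

lemma sigmoid_le_shift_of_timeCode_eq {N n T : ℕ} (hN : 0 < N) (hn : 0 < n) {s : ℝ} (h0 : 0 ≤ s)
    (h1 : s ≤ 1) (hb : timeCode N n T s = N * T) (k : ℕ) :
    sigmoid T ≤ shift k s := by
  have hN' : (0 : ℝ) < N := by exact_mod_cast hN
  have hNn : (0 : ℤ) < N * (n + T) := by positivity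
  have hNT : (0 : ℤ) ≤ N * T := by positivity
  rcases eq_zero_or_one_or_sigmoid h0 h1 with rfl | rfl | ⟨t, rfl⟩
  · rw [timeCode_zero] at hb
    linarith
  · rw [shift_one_right]
    exact Real.sigmoid_le_one _
  · rw [timeCode_sigmoid] at hb
    have h2 : (N * T : ℤ) ≤ ⌊N * t⌋ := by grind
    rw [Int.le_floor] at h2
    push_cast at h2
    rw [shift_sigmoid]
    have h3 : (T : ℝ) ≤ t := le_of_mul_le_mul_left h2 hN'
    exact Real.sigmoid_le (by linarith [(Nat.cast_nonneg k : (0 : ℝ) ≤ k)])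

lemma abs_sub_lt_of_floor_eq {N : ℕ} (hN : 0 < N) {a b : ℝ} (h : ⌊N * a⌋ = ⌊N * b⌋) :
    |a - b| < 1 / N := by
  have hN' : (0 : ℝ) < N := by exact_mod_cast hN
  have := Int.abs_sub_lt_one_of_floor_eq_floor h
  rw [← mul_sub, abs_mul, abs_of_pos hN'] at this
  rwa [lt_div_iff₀' hN']

lemma abs_shift_sub_lt_of_timeCode_eq {N n T k : ℕ} {δ s s' : ℝ} (hN : 0 < N)
    (hNδ : 1 / (N : ℝ) < δ) (hT : 1 - sigmoid (T - 1) < δ) (h0 : 0 ≤ s) (h1 : s ≤ 1)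
    (h0' : 0 ≤ s') (h1' : s' ≤ 1) (hk : k < n) (h : timeCode N n T s = timeCode N n T s') :
    |shift k s - shift k s'| < δ := by
  have hn : 0 < n := by omega
  have a0 := shift_nonneg k h0 h1
  have a1 := shift_le_one k h0 h1
  have a0' := shift_nonneg k h0' h1'
  have a1' := shift_le_one k h0' h1'
  by_cases hb : timeCode N n T s = -(N * (n + T))
  · have e := shift_le_of_timeCode_eq hN hn h0 h1 hb hk
    have e' := shift_le_of_timeCode_eq hN hn h0' h1' (h.symm.trans hb) hk
    rw [abs_lt]
    constructor <;> linarith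
  by_cases ht : timeCode N n T s = N * T
  · have e := sigmoid_le_shift_of_timeCode_eq hN hn h0 h1 ht k
    have e' := sigmoid_le_shift_of_timeCode_eq hN hn h0' h1' (h.symm.trans ht) k
    have : sigmoid (T - 1 : ℝ) ≤ sigmoid T := Real.sigmoid_le (by linarith)
    rw [abs_lt]
    constructor <;> linarith
  obtain ⟨t, rfl, e, -⟩ := sigmoid_of_timeCode_ne hN h0 h1 hb ht
  obtain ⟨t', rfl, e', -⟩ := sigmoid_of_timeCode_ne hN h0' h1' (h ▸ hb) (h ▸ ht)
  rw [shift_sigmoid, shift_sigmoid]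
  refine (abs_sigmoid_sub_le _ _).trans_lt ?_
  rw [add_sub_add_right_eq_sub]
  exact (abs_sub_lt_of_floor_eq hN (by rw [← e, ← e', h])).trans hNδ

/-- The orbit label, in units of `1 / N` and truncated to `[-R, R]`. -/
noncomputable def labelCode (N R : ℕ) (y : ℝ) : ℤ := ⌊N * truncate R y⌋

lemma labelCode_mem_Icc (N R : ℕ) (y : ℝ) :
    labelCode N R y ∈ Finset.Icc (-(N * R : ℤ)) (N * R) := by
  have h0 : -(R : ℝ) ≤ truncate R y := le_max_left _ _
  have hR : (0 : ℝ) ≤ R := Nat.cast_nonneg R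
  have h1 : truncate R y ≤ R := max_le (by linarith) (min_le_left _ _)
  have hN : (0 : ℝ) ≤ N := Nat.cast_nonneg N
  rw [Finset.mem_Icc, labelCode]
  constructor
  · rw [Int.le_floor]
    push_cast
    nlinarith
  · have : (⌊N * truncate R y⌋ : ℝ) ≤ N * R := (Int.floor_le _).trans (by nlinarith)
    exact_mod_cast this

/-- A finite set containing the time codes of all points, if `h s` differs from `q * s` by
at most `D / N` up to an error coming from rounding. -/
noncomputable def timeCodes (N n T q D : ℕ) : Finset (ℤ × ℤ × ℤ) :=
  let b : ℤ := -(N * (n + T))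
  let t : ℤ := N * T
  let J := Finset.Icc b t
  (({b, t} ×ˢ J ×ˢ J) ∪ (J ×ˢ {b, t} ×ˢ J)) ∪
    (J ×ˢ J ×ˢ Finset.Icc (-(D : ℤ)) D).image fun c =>
      (c.1, c.2.1, max b (min t ((1 + q) * c.2.1 - q * c.1 + c.2.2)))

lemma timeCode_mem_timeCodes {N n T q D : ℕ} {h : ℝ → ℝ} {H : ℝ} (hN : 0 < N)
    (hH : ∀ s : ℝ, 0 < s → s ≤ n + 2 * T → |h s - q * s| ≤ H) (hD : 2 + 2 * q + N * H ≤ D)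
    {w : ℝ × (Fin 3 → ℝ)} (hw : w ∈ flowSpace h) :
    (timeCode N n T (w.2 0), timeCode N n T (w.2 1), timeCode N n T (w.2 2)) ∈
      timeCodes N n T q D := by
  obtain ⟨y, s⟩ := w
  obtain ⟨hs, hs1, hs2⟩ := hw
  dsimp only at *
  have hJ (i) := timeCode_mem_Icc N n T (s i)
  simp only [timeCodes, Finset.mem_union, Finset.mem_product, Finset.mem_insert,
    Finset.mem_singleton, hJ, true_and, and_true]
  by_cases h0 : timeCode N n T (s 0) = -(N * (n + T)) ∨ timeCode N n T (s 0) = N * T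
  · exact Or.inl (Or.inl h0)
  by_cases h1 : timeCode N n T (s 1) = -(N * (n + T)) ∨ timeCode N n T (s 1) = N * T
  · exact Or.inl (Or.inr h1)
  right
  push Not at h0 h1
  obtain ⟨t0, e0, c0, l0, u0⟩ := sigmoid_of_timeCode_ne hN (hs 0).1 (hs 0).2 h0.1 h0.2
  obtain ⟨t1, e1, c1, l1, u1⟩ := sigmoid_of_timeCode_ne hN (hs 1).1 (hs 1).2 h1.1 h1.2
  have hy : 0 < y := by
    by_contra! hy
    rw [transition_of_nonpos _ hy, zero_mul, zero_mul, e0, e1] at hs1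
    have := mul_pos (Real.sigmoid_pos t1) (sub_pos.2 (Real.sigmoid_lt_one t0))
    linarith
  rw [transition_of_pos _ hy, e0, e1] at hs1
  rw [transition_of_pos _ hy, e1] at hs2
  have a1 := eq_sub_of_sigmoid_transition hs1
  rw [id] at a1
  rcases eq_zero_or_one_or_sigmoid (hs 2).1 (hs 2).2 with e2 | e2 | ⟨t2, e2⟩
  · rw [e2] at hs2
    have := mul_pos (Real.exp_pos (-h y⁻¹)) (Real.sigmoid_pos t1)
    linarith
  · rw [e2] at hs2
    linarith [Real.sigmoid_lt_one t1]
  rw [e2] at hs2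
  have a2 := eq_sub_of_sigmoid_transition hs2
  have hH' := hH y⁻¹ (inv_pos.2 hy) (by linarith)
  rw [Finset.mem_image]
  refine ⟨(⌊N * t0⌋, ⌊N * t1⌋, ⌊N * t2⌋ - ((1 + q) * ⌊N * t1⌋ - q * ⌊N * t0⌋)), ?_, ?_⟩
  · simp only [Finset.mem_product, ← c0, ← c1, hJ, true_and]
    rw [c0, c1, Finset.mem_Icc, ← abs_le, ← Int.cast_le (R := ℝ)]
    push_cast
    refine le_trans ?_ hD
    have hN' : (0 : ℝ) ≤ N := Nat.cast_nonneg N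
    have hq : (0 : ℝ) ≤ q := Nat.cast_nonneg q
    have p0 := mul_nonneg hq (Int.fract_nonneg (N * t0))
    have p1 := mul_nonneg hq (Int.fract_nonneg (N * t1))
    have r0 := mul_le_mul_of_nonneg_left (Int.fract_lt_one (N * t0)).le hq
    have r1 := mul_le_mul_of_nonneg_left (Int.fract_lt_one (N * t1)).le hq
    have p2 := Int.fract_nonneg (N * t2)
    have r2 := Int.fract_lt_one (N * t2)
    have p3 := Int.fract_nonneg (N * t1)
    have r3 := Int.fract_lt_one (N * t1)
    rw [abs_le] at hH'
    have q1 := mul_le_mul_of_nonneg_left hH'.1 hN'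
    have q2 := mul_le_mul_of_nonneg_left hH'.2 hN'
    have key : (⌊N * t2⌋ : ℝ) - ((1 + q) * ⌊N * t1⌋ - q * ⌊N * t0⌋) =
        -(N * (h y⁻¹ - q * y⁻¹)) - Int.fract (N * t2) + Int.fract (N * t1) +
          q * Int.fract (N * t1) - q * Int.fract (N * t0) := by
      unfold Int.fract
      rw [a2, a1]
      ring
    rw [key, abs_le]
    constructor <;> linarith
  · rw [c0, c1, e2, timeCode_sigmoid]
    simp

lemma card_timeCodes_le (N n T q D : ℕ) :
    (timeCodes N n T q D).card ≤ (N * (n + 2 * T) + 1) ^ 2 * (2 * D + 5) := by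
  have hJ : (Finset.Icc (-(N * (n + T) : ℤ)) (N * T)).card = N * (n + 2 * T) + 1 := by
    rw [Int.card_Icc]
    have : (N * T + 1 - -(N * (n + T)) : ℤ) = ((N * (n + 2 * T) + 1 : ℕ) : ℤ) := by
      push_cast; ring
    rw [this, Int.toNat_natCast]
  have hE : (Finset.Icc (-(D : ℤ)) D).card = 2 * D + 1 := by
    rw [Int.card_Icc]; omega
  have h2 : ({-(N * (n + T) : ℤ), (N * T : ℤ)} : Finset ℤ).card ≤ 2 := Finset.card_le_two
  unfold timeCodes
  refine (Finset.card_union_le _ _).trans ?_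
  refine (add_le_add (Finset.card_union_le _ _) Finset.card_image_le).trans ?_
  simp only [Finset.card_product, hJ, hE]
  generalize N * (n + 2 * T) + 1 = j
  generalize ({-(N * (n + T) : ℤ), (N * T : ℤ)} : Finset ℤ).card = m at *
  have := Nat.mul_le_mul_right (j * j) h2
  nlinarith

lemma abs_sub_lt_of_labelCode_eq {N R : ℕ} (hN : 0 < N) {y y' : ℝ}
    (h : labelCode N R y = labelCode N R y') : |truncate R y - truncate R y'| < 1 / N :=
  abs_sub_lt_of_floor_eq hN h

lemma exists_sigmoid_sub_one_lt {δ : ℝ} (hδ : 0 < δ) : ∃ T : ℕ, 1 - sigmoid (T - 1) < δ := by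
  have h1 : Tendsto (fun T : ℕ => sigmoid ((T : ℝ) - 1)) atTop (nhds 1) :=
    Real.tendsto_sigmoid_atTop.comp
      (tendsto_atTop_add_const_right _ (-1) tendsto_natCast_atTop_atTop)
  obtain ⟨T, hT⟩ := (h1.eventually (lt_mem_nhds (by linarith : 1 - δ < 1))).exists
  exact ⟨T, by linarith⟩

/-- For every `ε`, the cardinality of separated sets is bounded by the number of codes. -/
lemma exists_card_le_of_isSeparatedSet_s3 {h : ℝ → ℝ} (e : OnePoint (movingSpace h) ≃ₜ S2) (q : ℕ)
    {ε : ℝ} (hε : 0 < ε) : ∃ N T R : ℕ, ∀ (n D : ℕ) (H : ℝ), 1 ≤ n →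
      (∀ s : ℝ, 0 < s → s ≤ n + 2 * T → |h s - q * s| ≤ H) → 2 + 2 * q + N * H ≤ D →
      ∀ E : Finset S2, IsSeparatedSet (sphereMap e) ε n E →
        E.card ≤ (2 * (N * R) + 1) * ((N * (n + 2 * T) + 1) ^ 2 * (2 * D + 5)) + 1 := by
  obtain ⟨δ, hδ, R, hclose⟩ := exists_dist_lt_of_coords e hε
  obtain ⟨N', hN'⟩ := exists_nat_one_div_lt hδ
  obtain ⟨T, hT⟩ := exists_sigmoid_sub_one_lt hδ
  set N := N' + 1 with hNdef
  have hN : 0 < N := by omega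
  have hNδ : 1 / (N : ℝ) < δ := by rw [hNdef]; push_cast; exact hN'
  refine ⟨N, T, R, fun n D H hn hH hD E hE => ?_⟩
  classical
  let I := Finset.Icc (-(N * R : ℤ)) (N * R)
  have hI : I.card = 2 * (N * R) + 1 := by
    rw [Int.card_Icc]
    have : (N * R + 1 - -(N * R) : ℤ) = ((2 * (N * R) + 1 : ℕ) : ℤ) := by push_cast; ring
    rw [this, Int.toNat_natCast]
  let code : OnePoint (movingSpace h) → ℤ × ℤ × ℤ × ℤ := fun z =>
    z.elim 0 fun w => (labelCode N R w.1.1, timeCode N n T (w.1.2 0), timeCode N n T (w.1.2 1),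
      timeCode N n T (w.1.2 2))
  have hcard : (E.erase (e OnePoint.infty)).card ≤ (I ×ˢ timeCodes N n T q D).card := by
    refine Finset.card_le_card_of_injOn (fun x => code (e.symm x)) ?_ ?_
    · intro x hx
      rcases eq_infty_or_exists_eq e x with rfl | ⟨w, rfl⟩
      · simp at hx
      beta_reduce
      rw [e.symm_apply_apply]
      exact Finset.mem_product.2 ⟨labelCode_mem_Icc N R _, timeCode_mem_timeCodes hN hH hD w.2.1⟩
    · intro x hx x' hx' hxx'
      rcases eq_infty_or_exists_eq e x with rfl | ⟨w, rfl⟩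
      · simp at hx
      rcases eq_infty_or_exists_eq e x' with rfl | ⟨w', rfl⟩
      · simp at hx'
      simp only [e.symm_apply_apply, code, OnePoint.elim_some, Prod.mk.injEq] at hxx'
      obtain ⟨cy, c0, c1, c2⟩ := hxx'
      have hc : ∀ i, timeCode N n T (w.1.2 i) = timeCode N n T (w'.1.2 i) := by
        intro i; fin_cases i <;> assumption
      by_contra hne
      obtain ⟨k, hk, hd⟩ := hE _ (Finset.mem_of_mem_erase hx) _ (Finset.mem_of_mem_erase hx') hne
      rw [sphereMap_iterate, sphereMap_iterate] at hd
      refine hd.not_gt (hclose _ _ ?_ fun i => ?_)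
      · rw [movingMap_iterate, movingMap_iterate]
        exact (abs_sub_lt_of_labelCode_eq hN cy).trans hNδ
      · rw [movingMap_iterate, movingMap_iterate]
        exact abs_shift_sub_lt_of_timeCode_eq hN hNδ hT (w.2.1.1 i).1 (w.2.1.1 i).2
          (w'.2.1.1 i).1 (w'.2.1.1 i).2 hk (hc i)
  rw [Finset.card_product, hI] at hcard
  have h1 := Finset.pred_card_le_card_erase (s := E) (a := e OnePoint.infty)
  have h2 := Nat.mul_le_mul_left (2 * (N * R) + 1) (card_timeCodes_le N n T q D)
  omega

lemma sepDominated_sphereMap {h : ℝ → ℝ} (e : OnePoint (movingSpace h) ≃ₜ S2) (q : ℕ)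
    {L : ℕ → ℝ} (hL : ∀ n, 1 ≤ n → 1 / 2 ≤ L n)
    (hH : ∀ T : ℕ, ∃ C : ℝ, 0 ≤ C ∧ ∀ n : ℕ, 1 ≤ n → ∀ s : ℝ, 0 < s → s ≤ n + T →
      |h s - q * s| ≤ C * L n) :
    SepDominated (sphereMap e) fun n => (n : ℝ) ^ 2 * L n := by
  intro ε hε
  obtain ⟨N, T, R, hcard⟩ := exists_card_le_of_isSeparatedSet_s3 e q hε
  obtain ⟨C, hC, hH⟩ := hH (2 * T)
  let A : ℝ := 2 * (N * R) + 1
  let B : ℝ := N * (1 + 2 * T) + 1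
  let G : ℝ := 2 * (2 * (3 + 2 * q) + N * C) + 10
  refine ⟨A * (B ^ 2 * G) + 2, by positivity, fun n hn E hE => ?_⟩
  have hLn := hL n hn
  have hn' : (1 : ℝ) ≤ n := by exact_mod_cast hn
  have hx : 0 ≤ 2 + 2 * q + N * (C * L n) := by positivity
  have hD := hcard n ⌈2 + 2 * q + N * (C * L n)⌉₊ (C * L n) hn (by exact_mod_cast hH n hn)
    (Nat.le_ceil _) E hE
  have hceil := Nat.ceil_lt_add_one hx
  generalize ⌈2 + 2 * q + N * (C * L n)⌉₊ = D at hD hceil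
  have hD' : (E.card : ℝ) ≤ A * ((N * (n + 2 * T) + 1) ^ 2 * (2 * D + 5)) + 1 := by
    simp only [A]
    exact_mod_cast hD
  have h1 : (2 * D + 5 : ℝ) ≤ G * L n := by
    have : (0 : ℝ) ≤ q := Nat.cast_nonneg q
    simp only [G]
    nlinarith
  have h2 : (N * (n + 2 * T) + 1 : ℝ) ≤ B * n := by
    have : (0 : ℝ) ≤ N * T * (n - 1) := mul_nonneg (by positivity) (by linarith)
    simp only [B]
    nlinarith
  have h3 : (N * (n + 2 * T) + 1 : ℝ) ^ 2 * (2 * D + 5) ≤ (B * n) ^ 2 * (G * L n) := by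
    gcongr
  have h4 : A * ((N * (n + 2 * T) + 1 : ℝ) ^ 2 * (2 * D + 5)) ≤ A * ((B * n) ^ 2 * (G * L n)) := by
    have : 0 ≤ A := by positivity
    gcongr
  have h5 : 1 ≤ 2 * ((n : ℝ) ^ 2 * L n) := by nlinarith [mul_le_mul hn' hn' zero_le_one (by linarith)]
  calc (E.card : ℝ) ≤ A * ((B * n) ^ 2 * (G * L n)) + 2 * (n ^ 2 * L n) := by linarith
    _ = (A * (B ^ 2 * G) + 2) * (n ^ 2 * L n) := by ring

/-- For every `ε` below some bound, points whose `i`-th time coordinates lie in disjoint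
neighbouring intervals are far apart. -/
lemma exists_le_dist_of_coords {h : ℝ → ℝ} (hc : Continuous h) (ht : Tendsto h atTop atTop)
    (e : OnePoint (movingSpace h) ≃ₜ S2) (i : Fin 3) : ∃ ε > 0, ∀ u v : movingSpace h,
      u.1.1 ∈ Set.Icc (0 : ℝ) 1 → u.1.2 i ∈ Set.Icc (sigmoid 0) (sigmoid (1 / 2)) →
      v.1.2 i ∉ Set.Ioo (sigmoid (-1 / 2)) (sigmoid 1) → ε ≤ dist (e u) (e v) := by
  let f : movingSpace h → S2 := fun w => e w
  have hf : Topology.IsOpenEmbedding f := isOpenEmbedding_sphere_coe e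
  let K : Set (movingSpace h) := {u | u.1.1 ∈ Set.Icc (0 : ℝ) 1 ∧
    u.1.2 i ∈ Set.Icc (sigmoid 0) (sigmoid (1 / 2))}
  let V : Set (movingSpace h) :=
    (fun v => v.1.2 i) ⁻¹' Set.Ioo (sigmoid (-1 / 2)) (sigmoid 1)
  have hV : IsOpen (f '' V) := hf.isOpenMap V (isOpen_Ioo.preimage (by fun_prop))
  have hK : IsCompact K := by
    rw [Subtype.isCompact_iff]
    have hbox : IsCompact (Set.Icc (0 : ℝ) 1 ×ˢ Set.univ.pi fun _ : Fin 3 => Set.Icc (0 : ℝ) 1) :=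
      isCompact_Icc.prod (isCompact_univ_pi fun _ => isCompact_Icc)
    have : (Subtype.val '' K) = flowSpace h ∩
        ((fun w => (w.1, w.2 i)) ⁻¹' Set.Icc (0 : ℝ) 1 ×ˢ Set.Icc (sigmoid 0) (sigmoid (1 / 2))) := by
      ext w
      constructor
      · rintro ⟨w, hw, rfl⟩
        exact ⟨w.2.1, hw.1, hw.2⟩
      · rintro ⟨h1, h2, h3⟩
        exact ⟨⟨w, h1, i, (Real.sigmoid_pos _).trans_le h3.1,
          h3.2.trans_lt (Real.sigmoid_lt_one _)⟩, ⟨h2, h3⟩, rfl⟩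
    rw [this]
    refine hbox.of_isClosed_subset ((isClosed_flowSpace hc ht).inter
      ((isClosed_Icc.prod isClosed_Icc).preimage (by fun_prop))) ?_
    rintro w ⟨h1, h2, -⟩
    exact ⟨h2, fun i _ => h1.1 i⟩
  have hKV : f '' K ⊆ f '' V := by
    refine Set.image_mono fun u hu => ⟨?_, ?_⟩
    · exact (Real.sigmoid_lt (by norm_num)).trans_le hu.2.1
    · exact hu.2.2.trans_lt (Real.sigmoid_lt (by norm_num))
  obtain ⟨ε, hε, hsub⟩ := (hK.image hf.continuous).exists_thickening_subset_open hV hKV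
  refine ⟨ε, hε, fun u v hu1 hu2 hv => ?_⟩
  by_contra! hlt
  have : f v ∈ f '' V := hsub (Metric.mem_thickening_iff.2
    ⟨f u, ⟨u, ⟨hu1, hu2⟩, rfl⟩, by rw [dist_comm]; exact hlt⟩)
  obtain ⟨v', hv', hvv⟩ := this
  rw [hf.injective hvv] at hv'
  exact hv hv'

/-- The point at time `τ` of the second flow box, on the orbit with transit times `s`, `h s`. -/
noncomputable def orbitPoint (h : ℝ → ℝ) (s τ : ℝ) : ℝ × (Fin 3 → ℝ) :=
  (s⁻¹, fun i => sigmoid (![τ + s, τ, τ - h s] i))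

lemma orbitPoint_mem_movingSpace (h : ℝ → ℝ) {s : ℝ} (hs : 0 < s) (τ : ℝ) :
    orbitPoint h s τ ∈ movingSpace h := by
  refine ⟨⟨fun i => ⟨(Real.sigmoid_pos _).le, Real.sigmoid_le_one _⟩, ?_, ?_⟩, 0,
    Real.sigmoid_pos _, Real.sigmoid_lt_one _⟩
  · have := sigmoid_transition s (τ + s)
    simpa [orbitPoint, transition_of_pos _ (inv_pos.2 hs)] using this
  · have := sigmoid_transition (h s) τ
    simpa [orbitPoint, transition_of_pos _ (inv_pos.2 hs)] using this

/-- Orbits visiting the three flow boxes at different integer times are separated. -/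
lemma exists_isSeparatedSet_card_eq {h : ℝ → ℝ} (hc : Continuous h) (ht : Tendsto h atTop atTop)
    (e : OnePoint (movingSpace h) ≃ₜ S2) : ∃ ε > 0, ∀ (n : ℕ) (P : Finset (Fin 3 → ℕ)),
      (∀ k ∈ P, (∀ i, k i < n) ∧ ∃ s τ : ℝ, 1 ≤ s ∧
        ∀ i, ![τ + s, τ, τ - h s] i + k i ∈ Set.Icc (0 : ℝ) (1 / 2)) →
      ∃ E : Finset S2, IsSeparatedSet (sphereMap e) ε n E ∧ E.card = P.card := by
  choose δ hδ hsep using exists_le_dist_of_coords hc ht e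
  refine ⟨min (δ 0) (min (δ 1) (δ 2)), lt_min (hδ 0) (lt_min (hδ 1) (hδ 2)), fun n P hP => ?_⟩
  have hmin (i : Fin 3) : min (δ 0) (min (δ 1) (δ 2)) ≤ δ i := by fin_cases i <;> simp
  choose! s τ hs hτ using fun k hk => (hP k hk).2
  classical
  let p : (Fin 3 → ℕ) → OnePoint (movingSpace h) := fun k =>
    if hk : 0 < s k then ((⟨_, orbitPoint_mem_movingSpace h hk (τ k)⟩ : movingSpace h) :
      OnePoint (movingSpace h)) else OnePoint.infty
  have hpos (k) (hk : k ∈ P) : 0 < s k := zero_lt_one.trans_le (hs k hk)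
  have key : ∀ k ∈ P, ∀ k' ∈ P, ∀ i, k i ≠ k' i →
      δ i ≤ dist ((sphereMap e)^[k i] (e (p k))) ((sphereMap e)^[k i] (e (p k'))) := by
    intro k hk k' hk' i hi
    simp only [p, hpos k hk, hpos k' hk', dif_pos]
    rw [sphereMap_iterate, sphereMap_iterate]
    have t1 := hτ k hk i
    have t2 := hτ k' hk' i
    refine hsep i _ _ ?_ ?_ ?_
    · rw [movingMap_iterate]
      exact ⟨inv_nonneg.2 (hpos k hk).le, inv_le_one_of_one_le₀ (hs k hk)⟩
    · rw [movingMap_iterate]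
      simp only [flow, orbitPoint, shift_sigmoid]
      exact ⟨Real.sigmoid_le t1.1, Real.sigmoid_le t1.2⟩
    · rw [movingMap_iterate]
      simp only [flow, orbitPoint, shift_sigmoid, Set.mem_Ioo, Real.sigmoid_lt_iff, not_and, not_lt]
      intro h1
      rcases lt_or_gt_of_ne hi with hlt | hlt
      · have : (k i : ℝ) + 1 ≤ k' i := by exact_mod_cast hlt
        linarith [t2.2]
      · have : (k' i : ℝ) + 1 ≤ k i := by exact_mod_cast hlt
        linarith [t2.1]
  have hinj : Set.InjOn (fun k => e (p k)) P := by
    intro k hk k' hk' hkk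
    ext i
    by_contra hi
    have := key k hk k' hk' i hi
    beta_reduce at hkk
    rw [hkk, dist_self] at this
    linarith [hδ i]
  refine ⟨P.image fun k => e (p k), ?_, Finset.card_image_of_injOn hinj⟩
  intro x hx y hy hxy
  obtain ⟨k, hk, rfl⟩ := Finset.mem_image.1 hx
  obtain ⟨k', hk', rfl⟩ := Finset.mem_image.1 hy
  obtain ⟨i, hi⟩ : ∃ i, k i ≠ k' i := by
    by_contra! hall
    exact hxy (by rw [funext hall])
  exact ⟨k i, (hP k hk).1 i, (hmin i).trans (key k hk k' hk' i hi)⟩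

/-- An upper bound of the order of growth of the separated sets is the generalized entropy if
there are separated sets of proportional cardinality. -/
lemma HasGenEntropy.of_exists_card {M : Type*} [MetricSpace M] {f : M → M} {a : ℕ → ℝ}
    (hf : SepDominated f a) {ε c : ℝ} (hε : 0 < ε) (hc : 0 < c) (n₀ : ℕ)
    (hcard : ∀ n, n₀ ≤ n → ∃ E : Finset M, IsSeparatedSet f ε n E ∧ c * a n ≤ E.card) :
    HasGenEntropy f a := by
  refine ⟨hf, fun b hb hfb => ?_⟩
  obtain ⟨C, hC, hCb⟩ := hfb ε hε
  have hb1 : ∀ n, 1 ≤ n → b 1 ≤ b n := fun n hn => by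
    induction n, hn using Nat.le_induction with
    | base => exact le_rfl
    | succ n hn ih => exact ih.trans (hb.2 n hn)
  have hb0 := hb.1 1 le_rfl
  let S : ℝ := ∑ n ∈ Finset.range n₀, |a n|
  have hS : 0 ≤ S := Finset.sum_nonneg fun _ _ => abs_nonneg _
  refine ⟨C / c + S / b 1, by positivity, fun n hn => ?_⟩
  have hbn := hb.1 n hn
  rw [add_mul]
  by_cases h : n₀ ≤ n
  · obtain ⟨E, hE, hcE⟩ := hcard n h
    have h1 : a n ≤ C / c * b n := by
      rw [div_mul_eq_mul_div, le_div_iff₀ hc, mul_comm]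
      exact hcE.trans (hCb n hn E hE)
    have : 0 ≤ S / b 1 * b n := by positivity
    linarith
  · have h1 : |a n| ≤ S := Finset.single_le_sum (f := fun n => |a n|)
      (fun _ _ => abs_nonneg _) (Finset.mem_range.2 (not_le.1 h))
    have h2 : S ≤ S / b 1 * b n := by
      rw [div_mul_eq_mul_div, le_div_iff₀ hb0]
      exact mul_le_mul_of_nonneg_left (hb1 n hn) hS
    have : 0 ≤ C / c * b n := by positivity
    linarith [le_abs_self (a n)]

lemma hasGenEntropy_sphereMap_id (e : OnePoint (movingSpace id) ≃ₜ S2) :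
    HasGenEntropy (sphereMap e) fun n => (n : ℝ) ^ 2 := by
  obtain ⟨ε, hε, hsep⟩ := exists_isSeparatedSet_card_eq continuous_id tendsto_id e
  have hdom : SepDominated (sphereMap e) fun n => (n : ℝ) ^ 2 := by
    simpa using sepDominated_sphereMap (L := fun _ => 1) e 1 (by norm_num)
      fun T => ⟨0, le_rfl, fun n hn s _ _ => by simp⟩
  refine HasGenEntropy.of_exists_card hdom hε (by norm_num : (0 : ℝ) < 1 / 25) 3 fun n hn => ?_
  set A := n / 3 with hA
  let g : ℕ × ℕ → Fin 3 → ℕ := fun p => ![p.1, p.1 + (p.2 + 1), p.1 + 2 * (p.2 + 1)]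
  have hg : Function.Injective g := by
    rintro ⟨a, m⟩ ⟨a', m'⟩ h
    have h0 := congrFun h 0
    have h1 := congrFun h 1
    simp [g] at h0 h1
    grind
  obtain ⟨E, hE, hEc⟩ := hsep n ((Finset.range A ×ˢ Finset.range A).map ⟨g, hg⟩) <| by
    intro k hk
    obtain ⟨⟨a, m⟩, hp, rfl⟩ := Finset.mem_map.1 hk
    simp only [Finset.mem_product, Finset.mem_range] at hp
    refine ⟨fun i => ?_, (m : ℝ) + 1, -(a + (m + 1)), by simp, fun i => ?_⟩
    · fin_cases i <;> simp [g] <;> omega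
    · fin_cases i <;> simp [g] <;> ring_nf <;> norm_num
  refine ⟨E, hE, ?_⟩
  rw [hEc, Finset.card_map, Finset.card_product, Finset.card_range]
  have : (n : ℝ) ≤ 5 * A := by exact_mod_cast (by omega : n ≤ 5 * A)
  push_cast
  nlinarith [(Nat.cast_nonneg n : (0 : ℝ) ≤ n)]

/-- A function oscillating between `log (1 + s)` and `3 * log (1 + s)` on each unit interval. -/
noncomputable def logOscillation (s : ℝ) : ℝ := log (1 + |s|) * (2 + Real.cos (2 * Real.pi * s))

lemma continuous_logOscillation : Continuous logOscillation := by
  refine Continuous.mul (Continuous.log (by fun_prop) fun s => ?_) (by fun_prop)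
  positivity

lemma log_one_add_abs_nonneg (s : ℝ) : 0 ≤ log (1 + |s|) :=
  Real.log_nonneg (by linarith [abs_nonneg s])

lemma log_le_logOscillation (s : ℝ) : log (1 + |s|) ≤ logOscillation s := by
  have := Real.neg_one_le_cos (2 * Real.pi * s)
  exact le_mul_of_one_le_right (log_one_add_abs_nonneg s) (by linarith)

lemma logOscillation_le (s : ℝ) : logOscillation s ≤ 3 * log (1 + |s|) := by
  have := Real.cos_le_one (2 * Real.pi * s)
  rw [logOscillation, mul_comm]
  exact mul_le_mul_of_nonneg_right (by linarith) (log_one_add_abs_nonneg s)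

lemma tendsto_logOscillation : Tendsto logOscillation atTop atTop :=
  tendsto_atTop_mono log_le_logOscillation <| Real.tendsto_log_atTop.comp <|
    tendsto_atTop_add_const_left _ 1 tendsto_abs_atTop_atTop

lemma logOscillation_natCast (a : ℕ) : logOscillation a = 3 * log (1 + a) := by
  rw [logOscillation, abs_of_nonneg (Nat.cast_nonneg a),
    show 2 * Real.pi * a = a * (2 * Real.pi) by ring, Real.cos_nat_mul_two_pi]
  ring

lemma logOscillation_natCast_add_half (a : ℕ) :
    logOscillation (a + 1 / 2) = log (1 + (a + 1 / 2)) := by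
  rw [logOscillation, abs_of_nonneg (by positivity),
    show 2 * Real.pi * (a + 1 / 2) = a * (2 * Real.pi) + Real.pi by ring,
    Real.cos_nat_mul_two_pi_add_pi]
  ring

lemma exists_logOscillation_eq {a : ℕ} {b : ℝ} (h1 : log (1 + (a + 1 / 2)) ≤ b)
    (h2 : b ≤ 3 * log (1 + a)) : ∃ s : ℝ, a ≤ s ∧ s ≤ a + 1 / 2 ∧ logOscillation s = b := by
  have := intermediate_value_Icc' (by linarith : (a : ℝ) ≤ a + 1 / 2)
    continuous_logOscillation.continuousOn
  rw [logOscillation_natCast, logOscillation_natCast_add_half] at this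
  obtain ⟨s, hs, hb⟩ := this ⟨h1, h2⟩
  exact ⟨s, hs.1, hs.2, hb⟩

lemma half_le_log_add_one {n : ℕ} (hn : 1 ≤ n) : 1 / 2 ≤ log ((n : ℝ) + 1) := by
  have h1 : (1 : ℝ) ≤ n := by exact_mod_cast hn
  have := Real.log_le_log two_pos (by linarith : (2 : ℝ) ≤ n + 1)
  linarith [Real.log_two_gt_d9]

lemma sepDominated_sphereMap_logOscillation (e : OnePoint (movingSpace logOscillation) ≃ₜ S2) :
    SepDominated (sphereMap e) fun n => (n : ℝ) ^ 2 * log ((n : ℝ) + 1) := by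
  refine sepDominated_sphereMap e 0 (fun n hn => half_le_log_add_one hn) fun T =>
    ⟨3 + 6 * log (1 + T), ?_, fun n hn s hs hsn => ?_⟩
  · have := Real.log_nonneg (by linarith [(Nat.cast_nonneg T : (0 : ℝ) ≤ T)] : (1 : ℝ) ≤ 1 + T)
    positivity
  · have hT := Real.log_nonneg
      (by linarith [(Nat.cast_nonneg T : (0 : ℝ) ≤ T)] : (1 : ℝ) ≤ 1 + T)
    have hn2 := half_le_log_add_one hn
    have h0 := (log_one_add_abs_nonneg s).trans (log_le_logOscillation s)
    have h1 := logOscillation_le s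
    rw [abs_of_pos hs] at h1
    have h2 : log (1 + s) ≤ log ((n : ℝ) + 1) + log (1 + T) := by
      rw [← Real.log_mul (by positivity) (by positivity)]
      refine Real.log_le_log (by positivity) ?_
      have : (0 : ℝ) ≤ n * T := by positivity
      nlinarith
    rw [Nat.cast_zero, zero_mul, sub_zero, abs_of_nonneg h0]
    nlinarith

lemma two_le_log_of_le {x : ℝ} (hx : 9 ≤ x) : 2 ≤ log x := by
  rw [Real.le_log_iff_exp_le (by linarith)]
  have := Real.exp_one_lt_d9
  rw [show (2 : ℝ) = 1 + 1 by norm_num, Real.exp_add]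
  nlinarith [Real.exp_pos 1]

lemma hasGenEntropy_sphereMap_logOscillation (e : OnePoint (movingSpace logOscillation) ≃ₜ S2) :
    HasGenEntropy (sphereMap e) fun n => (n : ℝ) ^ 2 * log ((n : ℝ) + 1) := by
  obtain ⟨ε, hε, hsep⟩ := exists_isSeparatedSet_card_eq continuous_logOscillation
    tendsto_logOscillation e
  refine HasGenEntropy.of_exists_card (sepDominated_sphereMap_logOscillation e) hε
    (by norm_num : (0 : ℝ) < 1 / 1152) 48 fun n hn => ?_
  set A := n / 6 with hA
  have hA8 : 8 ≤ A := by omega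
  have hA8' : (8 : ℝ) ≤ A := by exact_mod_cast hA8
  have hnA : (n : ℝ) ≤ 12 * A := by exact_mod_cast (by omega : n ≤ 12 * A)
  set l := log (1 + A) with hl
  have hl2 : 2 ≤ l := two_le_log_of_le (by linarith)
  have hlA : l ≤ A := by
    have := Real.log_le_sub_one_of_pos (by linarith : (0 : ℝ) < 1 + A)
    linarith
  let g : ℕ × ℕ × ℕ → Fin 3 → ℕ := fun p =>
    ![A + p.1 - p.2.1, 2 * A + p.1, 2 * A + p.1 + p.2.2]
  let Q := Finset.range A ×ˢ Finset.range A ×ˢ Finset.Icc ⌈2 * l⌉₊ ⌊3 * l⌋₊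
  have hg : Set.InjOn g Q := by
    rintro ⟨j, a, b⟩ h ⟨j', a', b'⟩ h' hgg
    simp only [Q, Finset.coe_product, Set.mem_prod, Finset.mem_coe, Finset.mem_range] at h h'
    have h0 := congrFun hgg 0
    have h1 := congrFun hgg 1
    have h2 := congrFun hgg 2
    simp [g] at h0 h1 h2
    simp only [Prod.mk.injEq]
    omega
  obtain ⟨E, hE, hEc⟩ := hsep n (Q.image g) <| by
    intro k hk
    obtain ⟨⟨j, a, b⟩, hp, rfl⟩ := Finset.mem_image.1 hk
    simp only [Q, Finset.mem_product, Finset.mem_range, Finset.mem_Icc] at hp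
    obtain ⟨hj, ha, hb1, hb2⟩ := hp
    rw [Nat.ceil_le] at hb1
    rw [Nat.le_floor_iff (by linarith)] at hb2
    have ha' : (a : ℝ) + 1 ≤ A := by exact_mod_cast ha
    have hb3 : b ≤ 3 * A := by
      have : (b : ℝ) ≤ 3 * A := by linarith
      exact_mod_cast this
    obtain ⟨s, hs1, hs2, hsb⟩ := exists_logOscillation_eq (a := A + a) (b := b) (by
        refine le_trans ?_ hb1
        rw [hl, ← Nat.cast_ofNat, ← Real.log_pow]
        refine Real.log_le_log (by positivity) ?_
        push_cast
        nlinarith) (by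
        refine hb2.trans ?_
        push_cast
        have := Real.log_le_log (by positivity)
          (by linarith [(Nat.cast_nonneg a : (0 : ℝ) ≤ a)] : (1 : ℝ) + A ≤ 1 + (A + a))
        linarith)
    push_cast at hs1 hs2
    refine ⟨fun i => ?_, s, -(2 * A + j), by linarith [(Nat.cast_nonneg a : (0 : ℝ) ≤ a)],
      fun i => ?_⟩
    · fin_cases i <;> simp [g] <;> omega
    · have h1 : ((A + j - a : ℕ) : ℝ) = A + j - a := by
        rw [Nat.cast_sub (by omega)]
        push_cast
        rfl
      fin_cases i
      · simp [g, h1]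
        constructor <;> linarith
      · simp [g]
      · simp [g, hsb]
  refine ⟨E, hE, ?_⟩
  rw [hEc, Finset.card_image_of_injOn hg]
  have hI : l / 2 ≤ ((Finset.Icc ⌈2 * l⌉₊ ⌊3 * l⌋₊).card : ℝ) := by
    have h1 := Nat.ceil_lt_add_one (by linarith : 0 ≤ 2 * l)
    have h2 := Nat.lt_floor_add_one (3 * l)
    have h3 : (⌊3 * l⌋₊ + 1 : ℝ) ≤ ((⌊3 * l⌋₊ + 1 - ⌈2 * l⌉₊ : ℕ) : ℝ) + ⌈2 * l⌉₊ := by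
      exact_mod_cast le_tsub_add
    rw [Nat.card_Icc]
    linarith
  have hlog : log ((n : ℝ) + 1) ≤ 4 * l := by
    rw [hl, ← Nat.cast_ofNat, ← Real.log_pow]
    refine Real.log_le_log (by positivity) ?_
    have : (12 : ℝ) * A + 1 ≤ (1 + A) ^ 2 * 9 := by nlinarith
    nlinarith [sq_nonneg ((1 + A : ℝ))]
  simp only [Q, Finset.card_product, Finset.card_range]
  push_cast
  have h4 : (n : ℝ) ^ 2 * log ((n : ℝ) + 1) ≤ (12 * A) ^ 2 * (4 * l) := by
    have := half_le_log_add_one (by omega : 1 ≤ n)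
    gcongr
  have h5 := mul_le_mul_of_nonneg_left hI (by positivity : (0 : ℝ) ≤ A * A)
  linarith

/-- There are homeomorphisms `f₁, f₂` of `S²`, each with one non-wandering point,
with `o(f₁) = [n²]` and `o(f₂) = [n² log(n+1)]`; these orders of growth differ,
although both sequences lie between `n²` and `n³` up to constants (so the two maps
have the same polynomial entropy `2`). -/
theorem exists_same_polEntropy_different_genEntropy :
    ∃ f₁ f₂ : S2 ≃ₜ S2,
      (∃ p : S2, nonwanderingSet (⇑f₁) = {p}) ∧
      (∃ q : S2, nonwanderingSet (⇑f₂) = {q}) ∧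
      HasGenEntropy (⇑f₁) (fun n => (n : ℝ) ^ 2) ∧
      HasGenEntropy (⇑f₂) (fun n => (n : ℝ) ^ 2 * Real.log ((n : ℝ) + 1)) ∧
      (¬ ∃ C : ℝ, 0 < C ∧ ∀ n : ℕ, 1 ≤ n →
        (n : ℝ) ^ 2 * Real.log ((n : ℝ) + 1) ≤ C * (n : ℝ) ^ 2) ∧
      (∃ c : ℝ, 0 < c ∧ ∀ n : ℕ, 1 ≤ n →
        (n : ℝ) ^ 2 ≤ c * ((n : ℝ) ^ 2 * Real.log ((n : ℝ) + 1))) ∧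
      (∃ C : ℝ, 0 < C ∧ ∀ n : ℕ, 1 ≤ n →
        (n : ℝ) ^ 2 * Real.log ((n : ℝ) + 1) ≤ C * (n : ℝ) ^ 3) := by
  obtain ⟨e₁⟩ := nonempty_onePoint_homeomorph_sphere continuous_id tendsto_id
  obtain ⟨e₂⟩ := nonempty_onePoint_homeomorph_sphere continuous_logOscillation tendsto_logOscillation
  refine ⟨sphereMap e₁, sphereMap e₂, ⟨_, nonwanderingSet_sphereMap e₁⟩,
    ⟨_, nonwanderingSet_sphereMap e₂⟩, hasGenEntropy_sphereMap_id e₁,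
    hasGenEntropy_sphereMap_logOscillation e₂, ?_, ⟨2, two_pos, fun n hn => ?_⟩,
    ⟨1, one_pos, fun n hn => ?_⟩⟩
  · rintro ⟨C, -, hC⟩
    have hlog : Tendsto (fun n : ℕ => Real.log ((n : ℝ) + 1)) atTop atTop :=
      Real.tendsto_log_atTop.comp
        (tendsto_atTop_add_const_right _ 1 tendsto_natCast_atTop_atTop)
    obtain ⟨n, hn, hn1⟩ := ((hlog.eventually_gt_atTop C).and (eventually_ge_atTop 1)).exists
    have hn2 : (0 : ℝ) < (n : ℝ) ^ 2 := pow_pos (by exact_mod_cast hn1) 2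
    have := hC n hn1
    nlinarith
  · have := half_le_log_add_one hn
    nlinarith [sq_nonneg (n : ℝ)]
  · have := Real.log_le_sub_one_of_pos (by positivity : (0 : ℝ) < n + 1)
    rw [one_mul, pow_succ]
    exact mul_le_mul_of_nonneg_left (by linarith) (sq_nonneg _)
end

section
/- Let M be a compact metric space and f : M → M a homeomorphism. Then there exists a countable family (a_k)_{k∈ℕ} of nondecreasing sequences ℕ → (0,∞), each satisfying the bounded jump property, such that for every nondecreasing sequence b : ℕ → (0,∞): (for every ε > 0 there exists C > 0 with s_{f,ε}(n) ≤ C·b(n) for all n ≥ 1) if and only if (for every k there exists C > 0 with a_k(n) ≤ C·b(n) for all n ≥ 1). That is, the generalized entropy o(f) belongs to the countable completion of the set of orders of growth with the bounded jump property. -/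
open Filter

/-- `M` splits into `m` (possibly empty) pieces of diameter `< ε` in the Bowen metric
`max_{k < n} dist (f^k x) (f^k y)`. -/
def HasBowenPartition {M : Type*} [MetricSpace M] (f : M → M) (ε : ℝ) (n m : ℕ) : Prop :=
  ∃ φ : M → Fin m, ∀ x y, φ x = φ y → ∀ k < n, dist (f^[k] x) (f^[k] y) < ε

/-- The least number of pieces of small Bowen diameter into which `M` splits. -/
noncomputable def bowenPartitionNumber {M : Type*} [MetricSpace M] (f : M → M) (ε : ℝ)
    (n : ℕ) : ℕ :=
  sInf {m | HasBowenPartition f ε n m}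

section BowenPartition

variable {M : Type*} [MetricSpace M] {f : M → M} {ε : ℝ} {n m : ℕ}

lemma HasBowenPartition.of_fintype {ι : Type*} [Fintype ι] (φ : M → ι)
    (h : ∀ x y, φ x = φ y → ∀ k < n, dist (f^[k] x) (f^[k] y) < ε) :
    HasBowenPartition f ε n (Fintype.card ι) :=
  ⟨fun x => Fintype.equivFin ι (φ x), fun x y hxy => h x y ((Fintype.equivFin ι).injective hxy)⟩

lemma HasBowenPartition.mono {n' : ℕ} (h : HasBowenPartition f ε n m) (hn : n' ≤ n) :
    HasBowenPartition f ε n' m := by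
  obtain ⟨φ, hφ⟩ := h
  exact ⟨φ, fun x y hxy k hk => hφ x y hxy k (hk.trans_le hn)⟩

lemma HasBowenPartition.succ {N : ℕ} (h : HasBowenPartition f ε n m)
    (h1 : HasBowenPartition f ε 1 N) : HasBowenPartition f ε (n + 1) (m * N) := by
  obtain ⟨φ, hφ⟩ := h
  obtain ⟨ψ, hψ⟩ := h1
  have key := HasBowenPartition.of_fintype (f := f) (ε := ε) (n := n + 1)
    (fun x => (φ x, ψ (f^[n] x))) (by
      intro x y hxy k hk
      rw [Prod.mk.injEq] at hxy
      rcases Nat.lt_succ_iff_lt_or_eq.mp hk with hk | rfl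
      · exact hφ x y hxy.1 k hk
      · exact hψ _ _ hxy.2 0 one_pos)
  simpa using key

lemma IsSeparatedSet.card_le (h : HasBowenPartition f ε n m) {E : Finset M}
    (hE : IsSeparatedSet f ε n E) : E.card ≤ m := by
  obtain ⟨φ, hφ⟩ := h
  have hinj : Set.InjOn φ E := by
    intro x hx y hy hxy
    by_contra hne
    obtain ⟨k, hk, hd⟩ := hE x hx y hy hne
    exact absurd (hφ x y hxy k hk) hd.not_gt
  simpa using Finset.card_le_card_of_injOn φ (fun x _ => Finset.mem_univ (φ x)) hinj

/-- The atoms are given by attaching each point to a nearby point of a maximal separated set. -/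
lemma exists_isSeparatedSet_hasBowenPartition (hε : 0 < ε)
    (h : HasBowenPartition f (ε / 2) n m) :
    ∃ E : Finset M, IsSeparatedSet f (ε / 2) n E ∧ HasBowenPartition f ε n E.card := by
  classical
  have hfin : {c | ∃ E : Finset M, IsSeparatedSet f (ε / 2) n E ∧ E.card = c}.Finite :=
    (Set.finite_Iic m).subset (by rintro _ ⟨E, hE, rfl⟩; exact hE.card_le h)
  obtain ⟨_, ⟨E, hE, rfl⟩, hmax⟩ :=
    Set.exists_max_image _ id hfin ⟨0, ∅, by simp [IsSeparatedSet], rfl⟩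
  have hnear (x : M) : ∃ e : E, ∀ k < n, dist (f^[k] x) (f^[k] (e : M)) < ε / 2 := by
    by_contra! hfar
    by_cases hx : x ∈ E
    · obtain ⟨k, hk, hd⟩ := hfar ⟨x, hx⟩
      rw [dist_self] at hd
      linarith
    · have hins : IsSeparatedSet f (ε / 2) n (insert x E) := by
        intro y hy z hz hyz
        rcases Finset.mem_insert.mp hy with hyx | hy <;>
          rcases Finset.mem_insert.mp hz with hzx | hz
        · exact absurd (hyx.trans hzx.symm) hyz
        · exact hyx ▸ hfar ⟨z, hz⟩
        · obtain ⟨k, hk, hd⟩ := hfar ⟨y, hy⟩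
          exact ⟨k, hk, by rwa [hzx, dist_comm]⟩
        · exact hE y hy z hz hyz
      have := hmax _ ⟨_, hins, rfl⟩
      simp [Finset.card_insert_of_notMem hx] at this
  choose e he using hnear
  refine ⟨E, hE, ?_⟩
  simpa using HasBowenPartition.of_fintype e fun x y hxy k hk => by
    have hy := he y k hk
    rw [← hxy, dist_comm] at hy
    linarith [dist_triangle (f^[k] x) (f^[k] (e x : M)) (f^[k] y), he x k hk]

lemma hasBowenPartition_bowenPartitionNumber (h : ∃ m, HasBowenPartition f ε n m) :
    HasBowenPartition f ε n (bowenPartitionNumber f ε n) :=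
  Nat.sInf_mem h

lemma bowenPartitionNumber_le (h : HasBowenPartition f ε n m) :
    bowenPartitionNumber f ε n ≤ m :=
  Nat.sInf_le h

lemma exists_hasBowenPartition [CompactSpace M] (f : M → M) (hε : 0 < ε) (n : ℕ) :
    ∃ m, HasBowenPartition f ε n m := by
  have hone : ∃ N, HasBowenPartition f ε 1 N := by
    obtain ⟨t, -, ht, hcov⟩ :=
      finite_cover_balls_of_compact (isCompact_univ (X := M)) (half_pos hε)
    have := ht.fintype
    have hnear (x : M) : ∃ c : t, dist x c < ε / 2 := by
      simpa using hcov (Set.mem_univ x)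
    choose c hc using hnear
    refine ⟨_, HasBowenPartition.of_fintype c fun x y hxy k hk => ?_⟩
    obtain rfl : k = 0 := by omega
    have hy := hc y
    rw [← hxy] at hy
    simpa using (dist_triangle_right x y (c x : M)).trans_lt (by linarith [hc x])
  obtain ⟨N, hN⟩ := hone
  induction n with
  | zero => exact ⟨N, hN.mono zero_le_one⟩
  | succ n ih =>
    obtain ⟨m, hm⟩ := ih
    exact ⟨m * N, hm.succ hN⟩

lemma bowenPartitionNumber_le_succ [CompactSpace M] (f : M → M) (hε : 0 < ε) (n : ℕ) :
    bowenPartitionNumber f ε n ≤ bowenPartitionNumber f ε (n + 1) :=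
  bowenPartitionNumber_le <|
    (hasBowenPartition_bowenPartitionNumber (exists_hasBowenPartition f hε _)).mono n.le_succ

lemma bowenPartitionNumber_succ_le [CompactSpace M] (f : M → M) (hε : 0 < ε) (n : ℕ) :
    bowenPartitionNumber f ε (n + 1) ≤
      bowenPartitionNumber f ε n * bowenPartitionNumber f ε 1 :=
  bowenPartitionNumber_le <|
    (hasBowenPartition_bowenPartitionNumber (exists_hasBowenPartition f hε n)).succ
      (hasBowenPartition_bowenPartitionNumber (exists_hasBowenPartition f hε 1))

end BowenPartition

lemma GrowthSeq.apply_one_le {b : ℕ → ℝ} (hb : GrowthSeq b) {n : ℕ} (hn : 1 ≤ n) : b 1 ≤ b n :=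
  Nat.le_induction le_rfl (fun k hk ih => ih.trans (hb.2 k hk)) n hn

/-- The generalized entropy of a homeomorphism of a compact metric space belongs to
the countable completion of the orders of growth with the bounded jump property:
there is a countable family of nondecreasing positive BJP sequences having exactly
the same upper bounds (among orders of growth) as the family `{[s_{f,ε}] : ε > 0}`. -/
theorem genEntropy_mem_BJP_completion (M : Type*) [MetricSpace M] [CompactSpace M]
    (f : M ≃ₜ M) :
    ∃ A : ℕ → ℕ → ℝ,
      (∀ k, GrowthSeq (A k) ∧
        ∃ C : ℝ, 0 < C ∧ ∀ n : ℕ, 1 ≤ n → A k (n + 1) ≤ C * A k n) ∧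
      ∀ b : ℕ → ℝ, GrowthSeq b →
        (SepDominated (⇑f) b ↔
          ∀ k, ∃ C : ℝ, 0 < C ∧ ∀ n : ℕ, 1 ≤ n → A k n ≤ C * b n) := by
  have hε (k : ℕ) : (0 : ℝ) < 1 / (k + 1) := Nat.one_div_pos_of_nat
  refine ⟨fun k n => bowenPartitionNumber f (1 / (k + 1)) n + 1, fun k => ⟨⟨?_, ?_⟩, ?_⟩,
    fun b hb => ⟨fun h k => ?_, fun h ε hε0 => ?_⟩⟩
  · intro n _
    positivity
  · intro n _
    have := bowenPartitionNumber_le_succ f (hε k) n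
    simpa using this
  · refine ⟨bowenPartitionNumber f (1 / (k + 1)) 1 + 1, by positivity, fun n _ => ?_⟩
    have h : (bowenPartitionNumber f (1 / (k + 1)) (n + 1) : ℝ) ≤
        bowenPartitionNumber f (1 / (k + 1)) n * bowenPartitionNumber f (1 / (k + 1)) 1 := by
      exact_mod_cast bowenPartitionNumber_succ_le f (hε k) n
    have h0 : (0 : ℝ) ≤ bowenPartitionNumber f (1 / (k + 1)) n := Nat.cast_nonneg _
    have h1 : (0 : ℝ) ≤ bowenPartitionNumber f (1 / (k + 1)) 1 := Nat.cast_nonneg _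
    linarith
  · obtain ⟨C, hC, hCb⟩ := h _ (half_pos (hε k))
    have hb1 := hb.1 1 le_rfl
    refine ⟨C + (b 1)⁻¹, by positivity, fun n hn => ?_⟩
    obtain ⟨m, hm⟩ := exists_hasBowenPartition f (half_pos (hε k)) n
    obtain ⟨E, hE, hpart⟩ := exists_isSeparatedSet_hasBowenPartition (hε k) hm
    have hle : (bowenPartitionNumber f (1 / (k + 1)) n : ℝ) ≤ E.card := by
      exact_mod_cast bowenPartitionNumber_le hpart
    have hone : 1 ≤ (b 1)⁻¹ * b n := by
      rw [← inv_mul_cancel₀ hb1.ne']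
      gcongr
      exact hb.apply_one_le hn
    linarith [hCb n hn E hE]
  · obtain ⟨k, hk⟩ := exists_nat_one_div_lt hε0
    obtain ⟨C, hC, hCb⟩ := h k
    refine ⟨C, hC, fun n hn E hE => ?_⟩
    have hsep : IsSeparatedSet f (1 / (k + 1)) n E := fun x hx y hy hxy =>
      (hE x hx y hy hxy).imp fun j hj => ⟨hj.1, hk.le.trans hj.2⟩
    have hle : (E.card : ℝ) ≤ bowenPartitionNumber f (1 / (k + 1)) n := by
      exact_mod_cast hsep.card_le
        (hasBowenPartition_bowenPartitionNumber (exists_hasBowenPartition f (hε k) n))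
    linarith [hCb n hn]
end

section
/- Let a : ℕ → (0,∞) (indexed by n ≥ 1) be a nondecreasing sequence satisfying the linearly invariant property. Then limsup_{n→∞} log(a(n))/n = 0; that is, a has zero exponential growth rate. -/
open Filter

/-- A growth sequence is monotone on the positive integers. -/
theorem GrowthSeq.le_of_le {a : ℕ → ℝ} (ha : GrowthSeq a) {n k : ℕ} (hn : 1 ≤ n)
    (hnk : n ≤ k) : a n ≤ a k := by
  induction k, hnk using Nat.le_induction with
  | base => exact le_rfl
  | succ k hk ih => exact ih.trans (ha.2 k (hn.trans hk))

/-- Iterating `a (m * n) ≤ K * a n` along the powers of `m`. -/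
theorem le_pow_mul_of_mul_le {a : ℕ → ℝ} {m : ℕ} {K : ℝ} (hm : 1 ≤ m) (hK : 0 ≤ K)
    (h : ∀ n : ℕ, 1 ≤ n → a (m * n) ≤ K * a n) (k : ℕ) : a (m ^ k) ≤ K ^ k * a 1 := by
  induction k with
  | zero => simp
  | succ k ih =>
    calc a (m ^ (k + 1)) = a (m * m ^ k) := by rw [pow_succ']
      _ ≤ K * a (m ^ k) := h _ (Nat.one_le_pow _ _ hm)
      _ ≤ K * (K ^ k * a 1) := by gcongr
      _ = K ^ (k + 1) * a 1 := by ring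

/-- A growth sequence with `a (m * n) ≤ K * a n` is at most polynomial; logarithmic form. -/
theorem GrowthSeq.log_le {a : ℕ → ℝ} (ha : GrowthSeq a) {m : ℕ} {K : ℝ} (hm : 2 ≤ m)
    (hK : 1 ≤ K) (h : ∀ n : ℕ, 1 ≤ n → a (m * n) ≤ K * a n) {n : ℕ} (hn : 1 ≤ n) :
    Real.log (a n) ≤ (Real.log n / Real.log m + 1) * Real.log K + Real.log (a 1) := by
  have hbound : a n ≤ K ^ (Nat.log m n + 1) * a 1 :=
    (ha.le_of_le hn (Nat.lt_pow_succ_log_self (by lia) n).le).trans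
      (le_pow_mul_of_mul_le (by lia) (by linarith) h _)
  have hlog : (Nat.log m n : ℝ) ≤ Real.log n / Real.log m := Real.natLog_le_logb n m
  calc Real.log (a n) ≤ Real.log (K ^ (Nat.log m n + 1) * a 1) :=
        Real.log_le_log (ha.1 n hn) hbound
    _ = ((Nat.log m n : ℝ) + 1) * Real.log K + Real.log (a 1) := by
        rw [Real.log_mul (by positivity) (ha.1 1 le_rfl).ne', Real.log_pow]
        push_cast
        ring
    _ ≤ _ := by
        have := Real.log_nonneg hK
        gcongr

/-- `log (a n) / n → 0` for a growth sequence with `a (m * n) ≤ K * a n`. -/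
theorem GrowthSeq.tendsto_log_div {a : ℕ → ℝ} (ha : GrowthSeq a) {m : ℕ} {K : ℝ}
    (hm : 2 ≤ m) (hK : 1 ≤ K) (h : ∀ n : ℕ, 1 ≤ n → a (m * n) ≤ K * a n) :
    Tendsto (fun n : ℕ => Real.log (a n) / (n : ℝ)) atTop (nhds 0) := by
  have hconst (c : ℝ) : Tendsto (fun n : ℕ => c / (n : ℝ)) atTop (nhds 0) :=
    tendsto_const_div_atTop_nhds_zero_nat c
  have hlog : Tendsto (fun n : ℕ => Real.log n / (n : ℝ)) atTop (nhds 0) :=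
    Real.isLittleO_log_id_atTop.tendsto_div_nhds_zero.comp tendsto_natCast_atTop_atTop
  have hupper : Tendsto (fun n : ℕ => Real.log K / Real.log m * (Real.log n / (n : ℝ)) +
      (Real.log K + Real.log (a 1)) / (n : ℝ)) atTop (nhds 0) := by
    simpa using (hlog.const_mul (Real.log K / Real.log m)).add
      (hconst (Real.log K + Real.log (a 1)))
  refine tendsto_of_tendsto_of_tendsto_of_le_of_le' (hconst (Real.log (a 1))) hupper ?_ ?_
  · filter_upwards [eventually_ge_atTop 1] with n hn
    exact div_le_div_of_nonneg_right
      (Real.log_le_log (ha.1 1 le_rfl) (ha.le_of_le le_rfl hn)) n.cast_nonneg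
  · filter_upwards [eventually_ge_atTop 1] with n hn
    refine (div_le_div_of_nonneg_right (ha.log_le hm hK h hn) n.cast_nonneg).trans_eq ?_
    ring

/-- A nondecreasing positive sequence with the linearly invariant property has zero
exponential growth rate: `limsup_{n→∞} log(a(n))/n = 0`. -/
theorem LIP_zero_exponential_rate (a : ℕ → ℝ) (ha : GrowthSeq a)
    (hLIP : ∃ m : ℕ, 2 ≤ m ∧ ∃ C : ℝ, 0 < C ∧
      ∀ n : ℕ, 1 ≤ n → a (m * n) ≤ C * a n) :
    Filter.limsup (fun n : ℕ => Real.log (a n) / (n : ℝ)) Filter.atTop = 0 := by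
  obtain ⟨m, hm, C, -, h⟩ := hLIP
  refine (ha.tendsto_log_div hm (le_max_right C 1) fun n hn => (h n hn).trans ?_).limsup_eq
  exact mul_le_mul_of_nonneg_right (le_max_left C 1) (ha.1 n hn).le
end

section
/- Let M be a compact metric space and f : M → M a continuous map such that for every finite open cover 𝒰 of M the sequence a_{f,𝒰} satisfies the linearly invariant property. Then the topological entropy of f is zero; equivalently, for every ε > 0, limsup_{n→∞} log(s_{f,ε}(n))/n = 0. -/
open Filter

/-- The minimal cardinality of a subfamily of `𝒰^n` (dynamical refinements
`U_{i_0} ∩ f⁻¹(U_{i_1}) ∩ ⋯ ∩ f⁻ⁿ(U_{i_n})` of the cover `U`) covering `M`. -/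
noncomputable def coverNum {M : Type*} [TopologicalSpace M] {k : ℕ} (f : M → M)
    (U : Fin k → Set M) (n : ℕ) : ℕ :=
  sInf {m | ∃ W : Finset (Fin (n + 1) → Fin k),
    (∀ x : M, ∃ w ∈ W, ∀ j : Fin (n + 1), f^[(j : ℕ)] x ∈ U (w j)) ∧ W.card = m}

/-- The maximal cardinality of an `(n,ε)`-separated set, `s_{f,ε}(n)`. -/
noncomputable def sepNum {M : Type*} [MetricSpace M] (f : M → M) (ε : ℝ) (n : ℕ) : ℕ :=
  sSup {m | ∃ E : Finset M, IsSeparatedSet f ε n E ∧ E.card = m}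

section CoverNumbers

variable {M : Type*} [TopologicalSpace M] {k : ℕ} {f : M → M} {U : Fin k → Set M}

/-- The family of words `W` codes a subfamily of `𝒰^n` covering the space. -/
def IsWordCover (f : M → M) (U : Fin k → Set M) (n : ℕ)
    (W : Finset (Fin (n + 1) → Fin k)) : Prop :=
  ∀ x : M, ∃ w ∈ W, ∀ j : Fin (n + 1), f^[(j : ℕ)] x ∈ U (w j)

theorem IsWordCover.coverNum_le {n : ℕ} {W : Finset (Fin (n + 1) → Fin k)}
    (hW : IsWordCover f U n W) : coverNum f U n ≤ W.card :=
  Nat.sInf_le ⟨W, hW, rfl⟩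

theorem exists_isWordCover_card_eq_coverNum (hU : ∀ x : M, ∃ i, x ∈ U i) (n : ℕ) :
    ∃ W : Finset (Fin (n + 1) → Fin k), IsWordCover f U n W ∧ W.card = coverNum f U n := by
  refine Nat.sInf_mem (s := {m | ∃ W : Finset (Fin (n + 1) → Fin k),
    IsWordCover f U n W ∧ W.card = m}) ⟨_, Finset.univ, fun x => ?_, rfl⟩
  choose w hw using fun j : Fin (n + 1) => hU (f^[(j : ℕ)] x)
  exact ⟨w, Finset.mem_univ _, hw⟩

theorem coverNum_add_le (hU : ∀ x : M, ∃ i, x ∈ U i) (p q : ℕ) :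
    coverNum f U (p + q) ≤ coverNum f U p * coverNum f U q := by
  classical
  obtain ⟨V, hV, hVcard⟩ := exists_isWordCover_card_eq_coverNum (f := f) hU p
  obtain ⟨W, hW, hWcard⟩ := exists_isWordCover_card_eq_coverNum (f := f) hU q
  let concat : (Fin (p + 1) → Fin k) × (Fin (q + 1) → Fin k) → Fin (p + q + 1) → Fin k :=
    fun vw j => if h : (j : ℕ) ≤ p then vw.1 ⟨j, by omega⟩ else vw.2 ⟨j - p, by omega⟩
  have hcover : IsWordCover f U (p + q) ((V ×ˢ W).image concat) := by
    intro x
    obtain ⟨v, hv, hxv⟩ := hV x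
    obtain ⟨w, hw, hxw⟩ := hW (f^[p] x)
    refine ⟨_, Finset.mem_image_of_mem concat (Finset.mk_mem_product hv hw), fun j => ?_⟩
    by_cases h : (j : ℕ) ≤ p
    · simpa [concat, h] using hxv ⟨j, by omega⟩
    · have := hxw ⟨j - p, by omega⟩
      rw [← Function.iterate_add_apply, Nat.sub_add_cancel (by omega)] at this
      simpa [concat, h] using this
  calc coverNum f U (p + q) ≤ ((V ×ˢ W).image concat).card := hcover.coverNum_le
    _ ≤ (V ×ˢ W).card := Finset.card_image_le
    _ = coverNum f U p * coverNum f U q := by rw [Finset.card_product, hVcard, hWcard]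

theorem subadditive_log_coverNum (hU : ∀ x : M, ∃ i, x ∈ U i) :
    Subadditive fun n => Real.log (coverNum f U n) := by
  intro p q
  have hle := coverNum_add_le (f := f) hU p q
  rcases Nat.eq_zero_or_pos (coverNum f U (p + q)) with h | h
  · simp only [h, Nat.cast_zero, Real.log_zero]
    exact add_nonneg (Real.log_natCast_nonneg _) (Real.log_natCast_nonneg _)
  · have hpq : coverNum f U p * coverNum f U q ≠ 0 := by omega
    rw [mul_ne_zero_iff] at hpq
    rw [← Real.log_mul (by exact_mod_cast hpq.1) (by exact_mod_cast hpq.2)]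
    exact Real.log_le_log (by exact_mod_cast h) (by exact_mod_cast hle)

end CoverNumbers

/-- A sequence of natural numbers satisfying the linearly invariant property grows
subexponentially along the powers of `m`. -/
theorem tendsto_log_div_pow_of_linearlyInvariant {a : ℕ → ℕ} {m : ℕ} (hm : 2 ≤ m) {C : ℝ}
    (ha : ∀ n : ℕ, 1 ≤ n → (a (m * n) : ℝ) ≤ C * a n) :
    Tendsto (fun j : ℕ => Real.log (a (m ^ j)) / ((m ^ j : ℕ) : ℝ)) atTop (nhds 0) := by
  have hC : 0 ≤ Real.log (max C 1) := Real.log_nonneg (le_max_right _ _)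
  have hstep (j : ℕ) :
      Real.log (a (m ^ (j + 1))) ≤ Real.log (max C 1) + Real.log (a (m ^ j)) := by
    have hj := ha (m ^ j) (Nat.one_le_pow _ _ (by omega))
    rw [← pow_succ'] at hj
    replace hj := hj.trans (mul_le_mul_of_nonneg_right (le_max_left C 1) (Nat.cast_nonneg _))
    rcases Nat.eq_zero_or_pos (a (m ^ (j + 1))) with h | h
    · simp only [h, Nat.cast_zero, Real.log_zero]
      exact add_nonneg hC (Real.log_natCast_nonneg _)
    · have hpos : (0 : ℝ) < a (m ^ (j + 1)) := by exact_mod_cast h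
      have hne : (a (m ^ j) : ℝ) ≠ 0 := right_ne_zero_of_mul (hpos.trans_le hj).ne'
      rw [← Real.log_mul (by positivity) hne]
      exact Real.log_le_log hpos hj
  have hlinear (j : ℕ) :
      Real.log (a (m ^ j)) ≤ Real.log (a 1) + j * Real.log (max C 1) := by
    induction j with
    | zero => simp
    | succ j ih => push_cast; linarith [hstep j]
  have hm1 : (1 : ℝ) < m := by exact_mod_cast hm
  have hlim := ((tendsto_pow_const_div_const_pow_of_one_lt 0 hm1).const_mul
    (Real.log (a 1))).add ((tendsto_pow_const_div_const_pow_of_one_lt 1 hm1).const_mul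
    (Real.log (max C 1)))
  simp only [mul_zero, add_zero] at hlim
  refine squeeze_zero
    (fun j => div_nonneg (Real.log_natCast_nonneg _) (Nat.cast_nonneg _)) (fun j => ?_) hlim
  calc Real.log (a (m ^ j)) / ((m ^ j : ℕ) : ℝ)
      ≤ (Real.log (a 1) + j * Real.log (max C 1)) / ((m ^ j : ℕ) : ℝ) := by
        gcongr; exact hlinear j
    _ = _ := by push_cast; ring

theorem tendsto_log_coverNum_div {M : Type*} [TopologicalSpace M] {k : ℕ} {f : M → M}
    {U : Fin k → Set M} (hU : ∀ x : M, ∃ i, x ∈ U i) {m : ℕ} (hm : 2 ≤ m) {C : ℝ}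
    (hC : ∀ n : ℕ, 1 ≤ n → (coverNum f U (m * n) : ℝ) ≤ C * coverNum f U n) :
    Tendsto (fun n : ℕ => Real.log (coverNum f U n) / (n : ℝ)) atTop (nhds 0) := by
  have hsub := subadditive_log_coverNum (f := f) hU
  have hlim := hsub.tendsto_lim ⟨0, by
    rintro _ ⟨n, rfl⟩
    exact div_nonneg (Real.log_natCast_nonneg _) (Nat.cast_nonneg _)⟩
  have hpow : Tendsto (fun j : ℕ => m ^ j) atTop atTop :=
    tendsto_pow_atTop_atTop_of_one_lt hm
  rwa [tendsto_nhds_unique (hlim.comp hpow)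
    (tendsto_log_div_pow_of_linearlyInvariant hm hC)] at hlim

theorem sepNum_le_coverNum {M : Type*} [MetricSpace M] {k : ℕ} {f : M → M}
    {U : Fin k → Set M} {ε : ℝ} (hU : ∀ x : M, ∃ i, x ∈ U i)
    (hdist : ∀ i, ∀ x ∈ U i, ∀ y ∈ U i, dist x y < ε) (n : ℕ) :
    sepNum f ε n ≤ coverNum f U n := by
  refine csSup_le' ?_
  rintro _ ⟨E, hE, rfl⟩
  obtain ⟨W, hW, hWcard⟩ := exists_isWordCover_card_eq_coverNum (f := f) hU n
  choose w hwW hw using hW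
  rw [← hWcard]
  refine Finset.card_le_card_of_injOn w (fun x _ => hwW x) fun x hx y hy hxy => ?_
  by_contra hne
  obtain ⟨j, hj, hsep⟩ := hE x hx y hy hne
  refine (hdist _ _ (hw x ⟨j, by omega⟩) _ ?_).not_ge hsep
  rw [hxy]
  exact hw y ⟨j, by omega⟩

theorem exists_finite_open_cover_dist_lt (M : Type*) [MetricSpace M] [CompactSpace M]
    {ε : ℝ} (hε : 0 < ε) :
    ∃ (k : ℕ) (U : Fin k → Set M), (∀ i, IsOpen (U i)) ∧ (∀ x : M, ∃ i, x ∈ U i) ∧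
      ∀ i, ∀ x ∈ U i, ∀ y ∈ U i, dist x y < ε := by
  obtain ⟨t, -, ht, hcover⟩ := isCompact_univ.finite_cover_balls (X := M) (half_pos hε)
  have := ht.fintype
  refine ⟨Fintype.card t, fun i => Metric.ball ((Fintype.equivFin t).symm i : M) (ε / 2),
    fun i => Metric.isOpen_ball, fun x => ?_, fun i x hx y hy => ?_⟩
  · obtain ⟨c, hc, hxc⟩ := Set.mem_iUnion₂.1 (hcover (Set.mem_univ x))
    exact ⟨Fintype.equivFin t ⟨c, hc⟩, by simpa using hxc⟩
  · have := dist_triangle_right x y ((Fintype.equivFin t).symm i : M)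
    rw [Metric.mem_ball] at hx hy
    linarith

/-- If for every finite open cover `𝒰` the sequence `a_{f,𝒰}` satisfies the linearly
invariant property, then the topological entropy of `f` vanishes: for every `ε > 0`,
`limsup_{n→∞} log(s_{f,ε}(n))/n = 0`. -/
theorem LIP_covers_zero_entropy (M : Type*) [MetricSpace M] [CompactSpace M]
    (f : M → M) (hf : Continuous f)
    (hLIP : ∀ (k : ℕ) (U : Fin k → Set M), (∀ i, IsOpen (U i)) →
      (∀ x : M, ∃ i, x ∈ U i) →
      ∃ m : ℕ, 2 ≤ m ∧ ∃ C : ℝ, 0 < C ∧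
        ∀ n : ℕ, 1 ≤ n → (coverNum f U (m * n) : ℝ) ≤ C * (coverNum f U n : ℝ)) :
    ∀ ε : ℝ, 0 < ε →
      Filter.limsup (fun n : ℕ => Real.log ((sepNum f ε n : ℝ)) / (n : ℝ))
        Filter.atTop = 0 := by
  intro ε hε
  obtain ⟨k, U, hopen, hU, hdist⟩ := exists_finite_open_cover_dist_lt M hε
  obtain ⟨m, hm, C, -, hC⟩ := hLIP k U hopen hU
  refine (squeeze_zero
    (fun n => div_nonneg (Real.log_natCast_nonneg _) (Nat.cast_nonneg _)) (fun n => ?_)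
    (tendsto_log_coverNum_div hU hm hC)).limsup_eq
  gcongr ?_ / _
  rcases Nat.eq_zero_or_pos (sepNum f ε n) with h | h
  · simpa [h] using Real.log_natCast_nonneg _
  · exact Real.log_le_log (by exact_mod_cast h)
      (by exact_mod_cast sepNum_le_coverNum hU hdist n)
end

section
/- Let a, b : ℕ → (0,∞) be nondecreasing sequences (indexed by n ≥ 1) such that a satisfies the bounded jump property, let S ⊆ ℕ be a syndetic set, and suppose there exist constants c_1, c_2 > 0 with c_1·b(n) ≤ a(n) ≤ c_2·b(n) for all n ∈ S. Then [a] = [b]: there exist constants d_1, d_2 > 0 with d_1·b(n) ≤ a(n) ≤ d_2·b(n) for all n ≥ 1. -/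
open Filter

theorem GrowthSeq.mono {a : ℕ → ℝ} (ha : GrowthSeq a) {m n : ℕ} (hm : 1 ≤ m) (hmn : m ≤ n) :
    a m ≤ a n := by
  induction n, hmn using Nat.le_induction with
  | base => exact le_rfl
  | succ k hk ih => exact ih.trans (ha.2 k (hm.trans hk))

theorem le_pow_mul_of_bounded_jump {a : ℕ → ℝ} {C : ℝ} (hC : 0 < C)
    (h : ∀ n : ℕ, 1 ≤ n → a (n + 1) ≤ C * a n) {n : ℕ} (hn : 1 ≤ n) (k : ℕ) :
    a (n + k) ≤ C ^ k * a n := by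
  induction k with
  | zero => simp
  | succ k ih =>
    calc a (n + k + 1) ≤ C * a (n + k) := h _ (by omega)
      _ ≤ C * (C ^ k * a n) := by gcongr
      _ = C ^ (k + 1) * a n := by ring

/-- If `a` has the bounded jump property and `a`, `b` are comparable (up to constants)
on a syndetic set `S ⊆ ℕ`, then `[a] = [b]`. -/
theorem BJP_syndetic_comparison (a b : ℕ → ℝ) (ha : GrowthSeq a) (hb : GrowthSeq b)
    (hBJP : ∃ C : ℝ, 0 < C ∧ ∀ n : ℕ, 1 ≤ n → a (n + 1) ≤ C * a n)
    (S : Set ℕ) (hS : ∃ N : ℕ, ∀ n : ℕ, ∃ s ∈ S, n ≤ s ∧ s ≤ n + N)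
    (c₁ c₂ : ℝ) (hc₁ : 0 < c₁) (hc₂ : 0 < c₂)
    (hcomp : ∀ n ∈ S, c₁ * b n ≤ a n ∧ a n ≤ c₂ * b n) :
    ∃ d₁ : ℝ, 0 < d₁ ∧ ∃ d₂ : ℝ, 0 < d₂ ∧
      ∀ n : ℕ, 1 ≤ n → d₁ * b n ≤ a n ∧ a n ≤ d₂ * b n := by
  obtain ⟨C, hC, hjump⟩ := hBJP
  obtain ⟨N, hN⟩ := hS
  have ha0 : 0 < a (N + 1) := ha.1 _ (by omega)
  have hb0 : 0 < b 1 := hb.1 1 le_rfl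
  refine ⟨c₁ / C ^ N, by positivity, C ^ N * c₂ + a (N + 1) / b 1, by positivity,
    fun n hn => ⟨?_, ?_⟩⟩
  · obtain ⟨s, hsS, hns, hsN⟩ := hN n
    rw [div_mul_eq_mul_div, div_le_iff₀' (by positivity)]
    calc c₁ * b n ≤ c₁ * b s := by gcongr; exact hb.mono hn hns
      _ ≤ a s := (hcomp s hsS).1
      _ ≤ a (n + N) := ha.mono (hn.trans hns) hsN
      _ ≤ C ^ N * a n := le_pow_mul_of_bounded_jump hC hjump hn N
  · have hbn : 0 < b n := hb.1 n hn
    rw [add_mul]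
    rcases Nat.lt_or_ge N n with hNn | hNn
    · obtain ⟨m, rfl⟩ := Nat.exists_eq_add_of_le' hNn.le
      have hm : 1 ≤ m := by omega
      obtain ⟨s, hsS, hms, hsN⟩ := hN m
      calc a (m + N) ≤ C ^ N * a m := le_pow_mul_of_bounded_jump hC hjump hm N
        _ ≤ C ^ N * a s := by gcongr; exact ha.mono hm hms
        _ ≤ C ^ N * (c₂ * b s) := by gcongr; exact (hcomp s hsS).2
        _ ≤ C ^ N * (c₂ * b (m + N)) := by gcongr; exact hb.mono (hm.trans hms) hsN
        _ = C ^ N * c₂ * b (m + N) := by ring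
        _ ≤ _ := le_add_of_nonneg_right (by positivity)
    · calc a n ≤ a (N + 1) := ha.mono hn (by omega)
        _ = a (N + 1) / b 1 * b 1 := by field_simp
        _ ≤ a (N + 1) / b 1 * b n := by gcongr; exact hb.mono le_rfl hn
        _ ≤ _ := le_add_of_nonneg_left (by positivity)
end
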